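/- arXiv:1810.04473 — 4 statements merged into one kernel-verified Lean document; each statement's English description precedes it below -/
import Mathlib

section
/- If T is a tree in which every vertex of A_T has degree at most 3, then |D_T| ≤ 2|A_T| + 1. -/
open SimpleGraph

namespace URPaper

/-- `M` is a matching in the simple graph `G`: a finite set of edges of `G`
that are pairwise vertex-disjoint. -/
def IsMatchingSet {V : Type*} (G : SimpleGraph V) (M : Finset (Sym2 V)) : Prop :=
  (∀ e ∈ M, e ∈ G.edgeSet) ∧
    ∀ e ∈ M, ∀ f ∈ M, e ≠ f → ∀ v : V, v ∈ e → v ∉ f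

/-- The set of vertices covered by a set of edges. -/
def covered {V : Type*} (M : Finset (Sym2 V)) : Set V := {v | ∃ e ∈ M, v ∈ e}

/-- A matching `M` in `G` is uniquely restricted if no other matching of `G`
covers exactly the same set of vertices. -/
def IsURMatching {V : Type*} (G : SimpleGraph V) (M : Finset (Sym2 V)) : Prop :=
  IsMatchingSet G M ∧
    ∀ M' : Finset (Sym2 V), IsMatchingSet G M' → covered M' = covered M → M' = M

/-- The matching number `ν(G)`: the maximum size of a matching in `G`. -/
noncomputable def nu {V : Type*} (G : SimpleGraph V) : ℕ :=
  sSup {k | ∃ M : Finset (Sym2 V), IsMatchingSet G M ∧ M.card = k}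

/-- The uniquely restricted matching number `ν_ur(G)`: the maximum size of a
uniquely restricted matching in `G`. -/
noncomputable def nuUR {V : Type*} (G : SimpleGraph V) : ℕ :=
  sSup {k | ∃ M : Finset (Sym2 V), IsURMatching G M ∧ M.card = k}

/-- `D_G`: the set of vertices missed by at least one maximum matching of `G`. -/
def gallaiD {V : Type*} (G : SimpleGraph V) : Set V :=
  {v | ∃ M : Finset (Sym2 V), IsMatchingSet G M ∧ M.card = nu G ∧ v ∉ covered M}

/-- `A_G`: the set of vertices outside `D_G` having a neighbor in `D_G`. -/
def gallaiA {V : Type*} (G : SimpleGraph V) : Set V :=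
  {v | v ∉ gallaiD G ∧ ∃ u ∈ gallaiD G, G.Adj v u}

/-- `C_G = V(G) \ (A_G ∪ D_G)`. -/
def gallaiC {V : Type*} (G : SimpleGraph V) : Set V :=
  {v | v ∉ gallaiD G ∧ v ∉ gallaiA G}

/-- Membership in the family `𝒯`: trees `T` with `ν(T) = (n(T) - 1)/3`
(equivalently `3 ν(T) + 1 = n(T)`) such that every vertex of `A_T` has degree
at most `3` in `T`. -/
def MemT {V : Type*} (T : SimpleGraph V) : Prop :=
  T.IsTree ∧ (∀ v ∈ gallaiA T, (T.neighborSet v).ncard ≤ 3) ∧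
    3 * nu T + 1 = Nat.card V

/-- The graph obtained from `T` by contracting the set `S` to a single new
vertex (the vertex `none`), all other vertices being kept. -/
def contractSet {V : Type*} (T : SimpleGraph V) (S : Set V) :
    SimpleGraph (Option {x : V // x ∉ S}) where
  Adj a b :=
    match a, b with
    | some x, some y => T.Adj x y
    | some x, none => ∃ u ∈ S, T.Adj (x : V) u
    | none, some y => ∃ u ∈ S, T.Adj (y : V) u
    | none, none => False
  symm := by
    refine ⟨?_⟩
    rintro (_ | x) (_ | y) h
    · exact h
    · exact h
    · exact h
    · exact T.adj_symm h
  loopless := by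
    refine ⟨?_⟩
    rintro (_ | x) h
    · exact h
    · exact T.loopless.irrefl _ h

/-- The graph `BG1` from the paper, given by an explicit edge list. -/
def BG1 : SimpleGraph (Fin 10) :=
  SimpleGraph.fromEdgeSet {s(0,4), s(1,4), s(0,5), s(2,5), s(0,6), s(3,6), s(1,7), s(2,7), s(1,8), s(3,8), s(2,9), s(3,9)}

/-- The graph `BG2` from the paper, given by an explicit edge list. -/
def BG2 : SimpleGraph (Fin 13) :=
  SimpleGraph.fromEdgeSet {s(0,4), s(1,4), s(0,5), s(2,5), s(0,6), s(3,6), s(1,7), s(2,7), s(1,8), s(3,8), s(2,9), s(3,9), s(10,6), s(10,7), s(11,8), s(11,5), s(12,4), s(12,9)}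

/-- The graph `BG3` from the paper, given by an explicit edge list. -/
def BG3 : SimpleGraph (Fin 16) :=
  SimpleGraph.fromEdgeSet {s(0,1), s(1,2), s(2,3), s(3,4), s(4,5), s(5,0), s(6,7), s(7,8), s(8,9), s(9,10), s(10,11), s(11,6), s(12,0), s(12,6), s(13,2), s(13,8), s(14,4), s(14,10), s(15,12), s(15,13), s(15,14)}

/-- The graph `BG4` from the paper, given by an explicit edge list. -/
def BG4 : SimpleGraph (Fin 19) :=
  SimpleGraph.fromEdgeSet {s(0,1), s(1,2), s(2,3), s(3,4), s(4,5), s(5,0), s(6,7), s(7,8), s(8,9), s(9,10), s(10,11), s(11,6), s(12,0), s(13,1), s(14,2), s(15,3), s(16,4), s(17,5), s(12,6), s(13,7), s(14,8), s(15,9), s(16,10), s(17,11), s(18,12), s(18,14), s(18,16)}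

/-- The graph `BG5` from the paper, given by an explicit edge list. -/
def BG5 : SimpleGraph (Fin 16) :=
  SimpleGraph.fromEdgeSet {s(0,4), s(1,4), s(0,5), s(2,5), s(0,6), s(3,6), s(1,7), s(2,7), s(1,8), s(3,8), s(2,9), s(3,9), s(10,6), s(10,7), s(11,8), s(11,5), s(12,4), s(12,9), s(13,14), s(14,15), s(13,10), s(13,11), s(15,12)}

/-- The graph `BG6` from the paper, given by an explicit edge list. -/
def BG6 : SimpleGraph (Fin 19) :=
  SimpleGraph.fromEdgeSet {s(0,4), s(1,4), s(0,5), s(2,5), s(0,6), s(3,6), s(1,7), s(2,7), s(1,8), s(3,8), s(2,9), s(3,9), s(10,6), s(10,7), s(11,8), s(11,5), s(12,4), s(12,9), s(13,14), s(14,15), s(15,16), s(16,17), s(17,18), s(18,13), s(13,10), s(15,11), s(17,12)}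

/-- The graph `BG7` from the paper, given by an explicit edge list. -/
def BG7 : SimpleGraph (Fin 19) :=
  SimpleGraph.fromEdgeSet {s(0,1), s(1,2), s(2,3), s(3,4), s(4,5), s(5,0), s(6,7), s(7,8), s(8,9), s(9,10), s(10,11), s(11,6), s(12,0), s(12,6), s(13,2), s(13,8), s(14,4), s(14,10), s(15,12), s(15,13), s(15,14), s(17,16), s(16,18), s(17,9), s(17,5), s(18,3), s(18,11)}

/-- The graph `BG8` from the paper, given by an explicit edge list. -/
def BG8 : SimpleGraph (Fin 22) :=
  SimpleGraph.fromEdgeSet {s(0,1), s(1,2), s(2,3), s(3,4), s(4,5), s(5,0), s(6,7), s(7,8), s(8,9), s(9,10), s(10,11), s(11,6), s(12,0), s(13,1), s(14,2), s(15,3), s(16,4), s(17,5), s(12,6), s(13,7), s(14,8), s(15,9), s(16,10), s(17,11), s(18,12), s(18,14), s(18,16), s(19,20), s(20,21), s(19,13), s(19,15), s(21,17)}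

/-- The graph `BG9` from the paper, given by an explicit edge list. -/
def BG9 : SimpleGraph (Fin 25) :=
  SimpleGraph.fromEdgeSet {s(0,1), s(1,2), s(2,3), s(3,4), s(4,5), s(5,0), s(6,7), s(7,8), s(8,9), s(9,10), s(10,11), s(11,6), s(12,0), s(13,1), s(14,2), s(15,3), s(16,4), s(17,5), s(12,6), s(13,7), s(14,8), s(15,9), s(16,10), s(17,11), s(18,12), s(18,14), s(18,16), s(19,20), s(20,21), s(21,22), s(22,23), s(23,24), s(24,19), s(19,13), s(21,15), s(23,17)}

/-- The graph `GraphH1` from the paper, given by an explicit edge list. -/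
def GraphH1 : SimpleGraph (Fin 14) :=
  SimpleGraph.fromEdgeSet {s(0,4), s(1,4), s(0,5), s(2,5), s(0,6), s(3,6), s(1,7), s(2,7), s(1,8), s(3,8), s(2,9), s(3,9), s(10,6), s(10,7), s(11,8), s(11,5), s(12,4), s(12,9), s(13,10), s(13,11), s(13,12)}

/-- The graph `GraphH2` from the paper, given by an explicit edge list. -/
def GraphH2 : SimpleGraph (Fin 20) :=
  SimpleGraph.fromEdgeSet {s(0,1), s(1,2), s(2,3), s(3,4), s(4,5), s(5,0), s(6,7), s(7,8), s(8,9), s(9,10), s(10,11), s(11,6), s(12,0), s(13,1), s(14,2), s(15,3), s(16,4), s(17,5), s(12,6), s(13,7), s(14,8), s(15,9), s(16,10), s(17,11), s(18,12), s(18,14), s(18,16), s(19,13), s(19,15), s(19,17)}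

/-- Membership in the family `ℬ = {G₁, …, G₉}`, up to isomorphism. -/
def IsBlockB : ∀ (X : Type), SimpleGraph X → Prop := fun _ H =>
  Nonempty (H ≃g BG1) ∨ Nonempty (H ≃g BG2) ∨ Nonempty (H ≃g BG3) ∨
  Nonempty (H ≃g BG4) ∨ Nonempty (H ≃g BG5) ∨ Nonempty (H ≃g BG6) ∨
  Nonempty (H ≃g BG7) ∨ Nonempty (H ≃g BG8) ∨ Nonempty (H ≃g BG9)

/-- Membership in the family `ℬ_c = {G₁, G₂, G₃, G₄}`, up to isomorphism. -/
def IsBlockBc : ∀ (X : Type), SimpleGraph X → Prop := fun _ H =>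
  Nonempty (H ≃g BG1) ∨ Nonempty (H ≃g BG2) ∨ Nonempty (H ≃g BG3) ∨ Nonempty (H ≃g BG4)

/-- `G` (on vertex set `W`) arises from the tree `T` (on vertex set `V`) by
replacing every vertex of `S` by a graph from the family `𝓑`.  The map `π`
sends every vertex of `G` to the vertex of `T` it corresponds to:
* every fiber over a vertex outside `S` is a single vertex, and on these
  vertices `π` is an isomorphism with the corresponding induced subgraph of `T`;
* the fiber over a vertex `s ∈ S` induces a graph of the family `𝓑`;
* there are no edges between the fibers of two distinct vertices of `S`;
* for `s ∈ S` and `v ∉ S`, there is exactly one edge of `G` between the two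
  fibers if `sv ∈ E(T)` and none otherwise;
* each vertex of a fiber over `s ∈ S` has at most one neighbor outside this
  fiber (distinct attachment vertices), and a vertex of such a fiber having a
  neighbor outside the fiber has exactly two neighbors inside it
  (attachment only at vertices of degree `2` of the replacing graph). -/
def ArisesFrom (𝓑 : ∀ (X : Type), SimpleGraph X → Prop) {W V : Type}
    (G : SimpleGraph W) (T : SimpleGraph V) (S : Set V) (π : W → V) : Prop :=
  Function.Surjective π ∧
  (∀ v ∉ S, ∀ w w' : W, π w = v → π w' = v → w = w') ∧
  (∀ w w' : W, π w ∉ S → π w' ∉ S → (G.Adj w w' ↔ T.Adj (π w) (π w'))) ∧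
  (∀ s ∈ S, 𝓑 _ (G.induce (π ⁻¹' {s}))) ∧
  (∀ s ∈ S, ∀ s' ∈ S, s ≠ s' → ∀ w w' : W, π w = s → π w' = s' → ¬ G.Adj w w') ∧
  (∀ s ∈ S, ∀ v ∉ S, T.Adj s v →
    ∃! p : W × W, π p.1 = s ∧ π p.2 = v ∧ G.Adj p.1 p.2) ∧
  (∀ s ∈ S, ∀ v ∉ S, ¬ T.Adj s v →
    ∀ w w' : W, π w = s → π w' = v → ¬ G.Adj w w') ∧
  (∀ s ∈ S, ∀ w : W, π w = s → ∀ w₁ w₂ : W, π w₁ ≠ s → π w₂ ≠ s →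
    G.Adj w w₁ → G.Adj w w₂ → w₁ = w₂) ∧
  (∀ s ∈ S, ∀ w : W, π w = s → ∀ w' : W, π w' ≠ s → G.Adj w w' →
    (G.neighborSet w ∩ π ⁻¹' {s}).ncard = 2)

/-- Membership in the family `𝒢`: graphs arising from a tree `T ∈ 𝒯` by
replacing each vertex of a subset `S ⊆ D_T` by a graph of the family `ℬ`. -/
def InCalG {W : Type} (G : SimpleGraph W) : Prop :=
  ∃ (V : Type) (T : SimpleGraph V) (S : Set V) (π : W → V),
    Finite V ∧ MemT T ∧ S ⊆ gallaiD T ∧ ArisesFrom IsBlockB G T S π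

/-- `κ_G(P)`: the number of connected components of `G` whose induced graph
satisfies the (isomorphism invariant) predicate `P`. -/
noncomputable def kappa {W : Type} (G : SimpleGraph W)
    (P : ∀ (X : Type), SimpleGraph X → Prop) : ℕ :=
  Nat.card {c : G.ConnectedComponent // P _ (G.induce c.supp)}

/-- Membership in `𝒢₃`: cubic graphs of girth at least `5`. -/
def IsCubicGirth5 : ∀ (X : Type), SimpleGraph X → Prop := fun _ H =>
  (∀ v, (H.neighborSet v).ncard = 3) ∧ 5 ≤ H.egirth

/-- Being isomorphic to `H₁` or `H₂`. -/
def IsH1orH2 : ∀ (X : Type), SimpleGraph X → Prop := fun _ H =>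
  Nonempty (H ≃g GraphH1) ∨ Nonempty (H ≃g GraphH2)

lemma exists_pendant {V : Type} [Finite V] {G : SimpleGraph V} (h : G.IsAcyclic)
    {a b : V} (hab : G.Adj a b) : ∃ l p, G.Adj l p ∧ ∀ w, G.Adj l w → w = p := by
  haveI : Nonempty V := ⟨a⟩
  have ⟨u, v, p, hp, hmax⟩ := Walk.exists_isPath_forall_isPath_length_le_length G
  have hnil : ¬p.Nil := by
    intro hn
    have h0 : p.length = 0 := Walk.nil_iff_length_eq.mp hn
    have := hmax a b (Walk.cons hab Walk.nil) (by simp [hab.ne])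
    simp at this
    omega
  refine ⟨u, _, p.adj_snd hnil, fun w hadj ↦ ?_⟩
  apply h.eq_snd_of_adj_start hp hadj
  have : ¬(p.cons hadj.symm).IsPath := by grind [Walk.length_cons]
  grind [hp.cons]

lemma forest_konig {V : Type} [Fintype V] (n : ℕ) : ∀ (G : SimpleGraph V), G.IsAcyclic →
    G.support.ncard ≤ n →
    ∃ (M : Finset (Sym2 V)) (C : Finset V), IsMatchingSet G M ∧ C.card ≤ M.card ∧
      ∀ a b, G.Adj a b → a ∈ C ∨ b ∈ C := by
  classical
  induction n with
  | zero =>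
    intro G _ hn
    have h0 : G.support = ∅ := by
      rw [← Set.ncard_eq_zero]; omega
    refine ⟨∅, ∅, ⟨by simp, by simp⟩, by simp, fun a b hab => ?_⟩
    have : a ∈ G.support := ⟨b, hab⟩
    simp [h0] at this
  | succ n ih =>
    intro G hG hn
    by_cases hE : ∃ a b, G.Adj a b
    · obtain ⟨a, b, hab⟩ := hE
      obtain ⟨l, p, hlp, huniq⟩ := exists_pendant hG hab
      have hcard : (G.deleteIncidenceSet p).support.ncard ≤ n := by
        have h1 := Set.ncard_le_ncard (support_deleteIncidenceSet_subset G p)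
        have h2 : p ∈ G.support := ⟨l, hlp.symm⟩
        have h3 := Set.ncard_diff_singleton_add_one h2
        omega
      obtain ⟨M, C, ⟨hM1, hM2⟩, hMC, hC⟩ := ih _ (hG.anti (deleteIncidenceSet_le G p)) hcard
      have key : ∀ e ∈ M, l ∉ e ∧ p ∉ e := by
        intro e he
        have := hM1 e he
        induction e using Sym2.ind with
        | _ x y =>
          rw [mem_edgeSet, deleteIncidenceSet_adj] at this
          obtain ⟨hxy, hx, hy⟩ := this
          simp only [Sym2.mem_iff, not_or]
          refine ⟨⟨?_, ?_⟩, ?_, ?_⟩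
          · rintro rfl; exact hy (huniq _ hxy)
          · rintro rfl; exact hx (huniq _ hxy.symm)
          · exact fun h => hx h.symm
          · exact fun h => hy h.symm
      have hnot : s(l, p) ∉ M := fun h => (key _ h).1 (by simp)
      refine ⟨insert s(l, p) M, insert p C, ⟨?_, ?_⟩, ?_, ?_⟩
      · intro e he
        rcases Finset.mem_insert.mp he with rfl | he
        · exact hlp
        · exact edgeSet_mono (deleteIncidenceSet_le G p) (hM1 e he)
      · intro e he f hf hef v hve hvf
        rcases Finset.mem_insert.mp he with rfl | he <;>
          rcases Finset.mem_insert.mp hf with rfl | hf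
        · exact hef rfl
        · have := key f hf
          rcases Sym2.mem_iff.mp hve with rfl | rfl <;> tauto
        · have := key e he
          rcases Sym2.mem_iff.mp hvf with rfl | rfl <;> tauto
        · exact hM2 e he f hf hef v hve hvf
      · rw [Finset.card_insert_of_notMem hnot]
        exact (Finset.card_insert_le _ _).trans (by omega)
      · intro x y hxy
        simp only [Finset.mem_insert]
        by_cases hx : x = p
        · tauto
        by_cases hy : y = p
        · tauto
        have := hC x y (deleteIncidenceSet_adj.mpr ⟨hxy, hx, hy⟩)
        tauto
    · push Not at hE
      exact ⟨∅, ∅, ⟨by simp, by simp⟩, by simp, fun a b hab => absurd hab (hE a b)⟩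

lemma gallaiD_indep {V : Type} [Fintype V] {G : SimpleGraph V} (hG : G.IsAcyclic)
    {u v : V} (hu : u ∈ gallaiD G) (hv : v ∈ gallaiD G) : ¬ G.Adj u v := by
  classical
  intro huv
  obtain ⟨M₀, C, hM₀, hCM, hC⟩ := forest_konig _ G hG le_rfl
  have hnu : M₀.card ≤ nu G := by
    apply le_csSup
    · refine ⟨Fintype.card (Sym2 V), ?_⟩
      rintro k ⟨M, _, rfl⟩
      exact Finset.card_le_univ M
    · exact ⟨M₀, hM₀, rfl⟩
  have key : ∀ c ∈ C, c ∉ gallaiD G := by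
    rintro c hc ⟨M, ⟨hM1, hM2⟩, hMc, hcM⟩
    have hpick : ∀ e : Sym2 V, ∃ w, e ∈ M → w ∈ e ∧ w ∈ C := by
      intro e
      by_cases he : e ∈ M
      · have := hM1 e he
        induction e using Sym2.ind with
        | _ x y =>
          rcases hC x y this with h | h
          · exact ⟨x, fun _ => ⟨by simp, h⟩⟩
          · exact ⟨y, fun _ => ⟨by simp, h⟩⟩
      · exact ⟨u, fun h => absurd h he⟩
    choose f hf using hpick
    have hinj : Set.InjOn f M := by
      intro e he e' he' hee
      by_contra hne
      exact hM2 e he e' he' hne (f e) (hf e he).1 (hee ▸ (hf e' he').1)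
    have him : M.image f = C := by
      apply Finset.eq_of_subset_of_card_le
      · intro w hw
        obtain ⟨e, he, rfl⟩ := Finset.mem_image.mp hw
        exact (hf e he).2
      · rw [Finset.card_image_of_injOn hinj]; omega
    rw [← him] at hc
    obtain ⟨e, he, rfl⟩ := Finset.mem_image.mp hc
    exact hcM ⟨e, he, (hf e he).1⟩
  rcases hC u v huv with h | h
  · exact key _ h hu
  · exact key _ h hv

lemma exists_parent {V : Type} {G : SimpleGraph V} (hG : G.Connected) (r v : V) (h : v ≠ r) :
    ∃ w, G.Adj w v ∧ G.dist w r + 1 = G.dist v r := by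
  obtain ⟨p, hp⟩ := hG.exists_walk_length_eq_dist v r
  cases p with
  | nil => exact absurd rfl h
  | @cons _ w _ hadj q =>
    refine ⟨w, hadj.symm, ?_⟩
    have h1 := dist_le q
    have h2 := hG.dist_triangle (u := v) (v := w) (w := r)
    have h3 : G.dist v w = 1 := dist_eq_one_iff_adj.mpr hadj
    simp only [Walk.length_cons] at hp
    omega

/-- If `T` is a tree in which every vertex of `A_T` has degree
at most `3`, then `|D_T| ≤ 2 |A_T| + 1`. -/
theorem statement4 {V : Type} [Fintype V] (T : SimpleGraph V) (hT : T.IsTree)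
    (hdeg : ∀ v ∈ gallaiA T, (T.neighborSet v).ncard ≤ 3) :
    (gallaiD T).ncard ≤ 2 * (gallaiA T).ncard + 1 := by
  classical
  rcases (gallaiD T).eq_empty_or_nonempty with h0 | ⟨r, hr⟩
  · simp [h0]
  have hpar : ∀ v, ∃ w, v ≠ r → T.Adj w v ∧ T.dist w r + 1 = T.dist v r := by
    intro v
    by_cases h : v = r
    · exact ⟨r, fun h' => absurd h h'⟩
    · obtain ⟨w, hw⟩ := exists_parent hT.connected r v h
      exact ⟨w, fun _ => hw⟩
  choose f hf using hpar
  have hA : ∀ v ∈ gallaiD T, v ≠ r → f v ∈ gallaiA T := by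
    intro v hv hvr
    exact ⟨fun h => gallaiD_indep hT.isAcyclic h hv (hf v hvr).1, v, hv, (hf v hvr).1⟩
  have hle : ((gallaiD T).toFinset.erase r).card ≤ 2 * (gallaiA T).toFinset.card := by
    apply Finset.card_le_mul_card_image_of_maps_to (f := f)
    · intro v hv
      simp only [Finset.coe_erase, Set.coe_toFinset, Set.mem_diff, Set.mem_singleton_iff,
        Finset.mem_erase, Set.mem_toFinset] at hv ⊢
      first | exact hA v hv.1 hv.2 | exact hA v hv.2 hv.1
    · intro a ha
      rw [Set.mem_toFinset] at ha
      have har : a ≠ r := by rintro rfl; exact ha.1 hr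
      have h3 := hdeg a ha
      rw [Set.ncard_eq_toFinset_card'] at h3
      have hsub : insert (f a) (((gallaiD T).toFinset.erase r).filter (fun v => f v = a)) ⊆
          (T.neighborSet a).toFinset := by
        intro x hx
        rw [Set.mem_toFinset, mem_neighborSet]
        rcases Finset.mem_insert.mp hx with rfl | hx
        · exact (hf a har).1.symm
        · simp only [Finset.mem_filter, Finset.mem_erase] at hx
          rw [← hx.2]
          exact (hf x hx.1.1).1
      have hnot : f a ∉ ((gallaiD T).toFinset.erase r).filter (fun v => f v = a) := by
        intro hx
        simp only [Finset.mem_filter, Finset.mem_erase] at hx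
        have h1 := (hf a har).2
        have h2 := (hf _ hx.1.1).2
        rw [hx.2] at h2
        omega
      have h4 := Finset.card_le_card hsub
      rw [Finset.card_insert_of_notMem hnot] at h4
      omega
  have h5 : ((gallaiD T).toFinset.erase r).card + 1 = (gallaiD T).toFinset.card :=
    Finset.card_erase_add_one (by simpa using hr)
  rw [Set.ncard_eq_toFinset_card', Set.ncard_eq_toFinset_card']
  omega

end URPaper
end

section
/- If T is a tree in 𝒯, then C_T = ∅, A_T is an independent set of T, every vertex of A_T has degree exactly 3 in T, and ν(T) = |A_T|. -/
open SimpleGraph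

namespace URPaper

section helpers
open Classical

lemma card_le_nu {V : Type} [Fintype V] {G : SimpleGraph V} {M : Finset (Sym2 V)}
    (h : IsMatchingSet G M) : M.card ≤ nu G := by
  apply le_csSup
  · refine ⟨Fintype.card (Sym2 V), ?_⟩
    rintro k ⟨N, -, rfl⟩
    exact Finset.card_le_univ N
  · exact ⟨M, h, rfl⟩

lemma exists_max {V : Type} [Fintype V] (G : SimpleGraph V) :
    ∃ M, IsMatchingSet G M ∧ M.card = nu G := by
  have : nu G ∈ {k | ∃ M : Finset (Sym2 V), IsMatchingSet G M ∧ M.card = k} := by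
    apply Nat.sSup_mem
    · exact ⟨0, ∅, by simp [IsMatchingSet]⟩
    · refine ⟨Fintype.card (Sym2 V), ?_⟩
      rintro k ⟨N, -, rfl⟩
      exact Finset.card_le_univ N
  exact this

lemma swap {V : Type} {G : SimpleGraph V} {M : Finset (Sym2 V)} {e f : Sym2 V}
    (h : IsMatchingSet G M) (he : e ∈ M) (hf : f ∈ G.edgeSet) (hfM : f ∉ M)
    (hc : ∀ v ∈ f, v ∈ covered M → v ∈ e) :
    IsMatchingSet G (insert f (M.erase e)) ∧ (insert f (M.erase e)).card = M.card := by
  refine ⟨⟨?_, ?_⟩, ?_⟩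
  · intro g hg
    rcases Finset.mem_insert.1 hg with rfl | hg
    · exact hf
    · exact h.1 g (Finset.mem_of_mem_erase hg)
  · have key : ∀ g ∈ M.erase e, ∀ v, v ∈ f → v ∉ g := by
      intro g hg v hv hvg
      have hg' := Finset.mem_erase.1 hg
      exact h.2 g hg'.2 e he hg'.1 v hvg (hc v hv ⟨g, hg'.2, hvg⟩)
    intro g hg k hk hne v hvg hvk
    rcases Finset.mem_insert.1 hg with h1 | hg <;> rcases Finset.mem_insert.1 hk with h2 | hk
    · exact hne (h1.trans h2.symm)
    · exact key k hk v (h1 ▸ hvg) hvk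
    · exact key g hg v (h2 ▸ hvk) hvg
    · exact h.2 g (Finset.mem_of_mem_erase hg) k (Finset.mem_of_mem_erase hk) hne v hvg hvk
  · rw [Finset.card_insert_of_notMem (fun hh => hfM (Finset.mem_of_mem_erase hh)),
      Finset.card_erase_of_mem he]
    have := Finset.card_pos.2 ⟨e, he⟩
    omega

/-- adding an edge both of whose ends are missed contradicts maximality -/
lemma no_aug {V : Type} [Fintype V] {G : SimpleGraph V} {M : Finset (Sym2 V)} {x y : V}
    (h : IsMatchingSet G M) (hM : M.card = nu G) (hxy : G.Adj x y)
    (hx : x ∉ covered M) : y ∈ covered M := by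
  by_contra hy
  have hnot : s(x, y) ∉ M := fun hh => hx ⟨_, hh, Sym2.mem_mk_left _ _⟩
  have key : ∀ g ∈ M, ∀ v, v ∈ s(x, y) → v ∉ g := by
    intro g hg v hv hvg
    rcases Sym2.mem_iff.1 hv with rfl | rfl
    · exact hx ⟨g, hg, hvg⟩
    · exact hy ⟨g, hg, hvg⟩
  have : IsMatchingSet G (insert s(x, y) M) := by
    refine ⟨?_, ?_⟩
    · intro g hg
      rcases Finset.mem_insert.1 hg with rfl | hg
      · exact hxy
      · exact h.1 g hg
    · intro g hg k hk hne v hvg hvk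
      rcases Finset.mem_insert.1 hg with rfl | hg <;> rcases Finset.mem_insert.1 hk with rfl | hk
      · exact hne rfl
      · exact key k hk v hvg hvk
      · exact key g hg v hvk hvg
      · exact h.2 g hg k hk hne v hvg hvk
  have h1 := card_le_nu this
  rw [Finset.card_insert_of_notMem hnot] at h1
  omega

lemma cov_edge {V : Type} {G : SimpleGraph V} {M : Finset (Sym2 V)} {x : V}
    (h : IsMatchingSet G M) (hx : x ∈ covered M) : ∃ y, s(x, y) ∈ M ∧ G.Adj x y := by
  obtain ⟨e, he, hxe⟩ := hx
  obtain ⟨y, rfl⟩ := hxe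
  exact ⟨y, he, h.1 _ he⟩

lemma uniq {V : Type} {G : SimpleGraph V} {M : Finset (Sym2 V)} {x y z : V}
    (h : IsMatchingSet G M) (hy : s(x, y) ∈ M) (hz : s(x, z) ∈ M) : y = z := by
  by_contra hne
  refine h.2 _ hy _ hz ?_ x (Sym2.mem_mk_left _ _) (Sym2.mem_mk_left _ _)
  intro heq
  exact hne (Sym2.congr_right.1 heq)

lemma exchange {V : Type} [Fintype V] {G : SimpleGraph V} (c : G.Coloring (Fin 2))
    {M : Finset (Sym2 V)} (hM : IsMatchingSet G M) (hMn : M.card = nu G) :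
    ∀ (k : ℕ) (N : Finset (Sym2 V)) (w : V), (M \ N).card = k →
      IsMatchingSet G N → N.card = nu G → w ∉ covered N →
      ∃ M', IsMatchingSet G M' ∧ M'.card = nu G ∧ w ∉ covered M' ∧ M ∩ N ⊆ M' ∧
        (∀ e ∈ M, (∀ v ∈ e, v ∉ gallaiD G) → e ∈ M') ∧
        (∀ z, z ∉ covered M → c z ≠ c w → z ∉ covered M') := by
  intro k
  induction k with
  | zero =>
    intro N w hk hN hNn hw
    have hsub : M ⊆ N := by
      rw [Finset.card_eq_zero] at hk
      exact Finset.sdiff_eq_empty_iff_subset.1 hk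
    have : M = N := Finset.eq_of_subset_of_card_le hsub (by omega)
    subst this
    exact ⟨M, hM, hMn, hw, Finset.inter_subset_left, fun e he _ => he, fun z hz _ => hz⟩
  | succ k ih =>
    intro N w hk hN hNn hw
    by_cases hwM : w ∈ covered M
    swap
    · exact ⟨M, hM, hMn, hwM, Finset.inter_subset_left, fun e he _ => he, fun z hz _ => hz⟩
    obtain ⟨w1, hw1, hadj⟩ := cov_edge hM hwM
    obtain ⟨w2, hw2, hadj2⟩ := cov_edge hN (no_aug hN hNn hadj hw)
    have hww2 : w ≠ w2 := by
      rintro rfl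
      exact hw ⟨_, hw2, Sym2.mem_mk_right _ _⟩
    have h12M : s(w1, w2) ∉ M := by
      intro hh
      exact hww2 (uniq hM (by rwa [Sym2.eq_swap]) hh)
    have h01N : s(w, w1) ∉ N := fun hh => hw ⟨_, hh, Sym2.mem_mk_left _ _⟩
    have hsw := swap hN hw2 (f := s(w, w1)) hadj h01N (by
      intro v hv hvc
      rcases Sym2.mem_iff.1 hv with rfl | rfl
      · exact absurd hvc hw
      · exact Sym2.mem_mk_left _ _)
    set N' := insert s(w, w1) (N.erase s(w1, w2)) with hN'
    have hw2N' : w2 ∉ covered N' := by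
      rintro ⟨e, he, hwe⟩
      rcases Finset.mem_insert.1 he with rfl | he
      · rcases Sym2.mem_iff.1 hwe with h | h
        · exact hww2 h.symm
        · exact hadj2.ne h.symm
      · have he' := Finset.mem_erase.1 he
        exact hN.2 e he'.2 _ hw2 he'.1 w2 hwe (Sym2.mem_mk_right _ _)
    have hcard : (M \ N').card = k := by
      have : M \ N' = (M \ N).erase s(w, w1) := by
        ext e
        simp only [hN', Finset.mem_sdiff, Finset.mem_insert, Finset.mem_erase]
        constructor
        · rintro ⟨h1, h2⟩
          push Not at h2
          refine ⟨h2.1, h1, fun h3 => h2.2 ?_ h3⟩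
          rintro rfl
          exact h12M h1
        · rintro ⟨h1, h2, h3⟩
          refine ⟨h2, ?_⟩
          rintro (h | h)
          · exact h1 h
          · exact h3 h.2
      rw [this, Finset.card_erase_of_mem (Finset.mem_sdiff.2 ⟨hw1, h01N⟩), hk]
      rfl
    obtain ⟨M', hM', hM'n, hw2M', hsub, hret, hcol⟩ :=
      ih N' w2 hcard hsw.1 (hsw.2.trans hNn) hw2N'
    have hww1 : s(w, w1) ∈ M' :=
      hsub (Finset.mem_inter.2 ⟨hw1, Finset.mem_insert_self _ _⟩)
    have h12M' : s(w1, w2) ∉ M' := fun hh => hw2M' ⟨_, hh, Sym2.mem_mk_right _ _⟩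
    have hsw' := swap hM' hww1 (f := s(w1, w2)) hadj2 h12M' (by
      intro v hv hvc
      rcases Sym2.mem_iff.1 hv with rfl | rfl
      · exact Sym2.mem_mk_right _ _
      · exact absurd hvc hw2M')
    have hcc : c w2 = c w := by
      have h1 := c.valid hadj
      have h2 := c.valid hadj2
      generalize c w = a at *
      generalize c w1 = b at *
      generalize c w2 = d at *
      omega
    refine ⟨_, hsw'.1, hsw'.2.trans hM'n, ?_, ?_, ?_, ?_⟩
    · rintro ⟨e, he, hwe⟩
      rcases Finset.mem_insert.1 he with rfl | he
      · rcases Sym2.mem_iff.1 hwe with h | h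
        · exact hadj.ne h
        · exact hww2 h
      · have he' := Finset.mem_erase.1 he
        exact hM'.2 e he'.2 _ hww1 he'.1 w hwe (Sym2.mem_mk_left _ _)
    · intro e he
      have he' := Finset.mem_inter.1 he
      refine Finset.mem_insert_of_mem (Finset.mem_erase.2 ⟨?_, hsub ?_⟩)
      · rintro rfl
        exact h01N he'.2
      · refine Finset.mem_inter.2 ⟨he'.1, Finset.mem_insert_of_mem (Finset.mem_erase.2 ⟨?_, he'.2⟩)⟩
        rintro rfl
        exact h12M he'.1
    · intro e he hD
      refine Finset.mem_insert_of_mem (Finset.mem_erase.2 ⟨?_, hret e he hD⟩)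
      rintro rfl
      exact hD w (Sym2.mem_mk_left _ _) ⟨N, hN, hNn, hw⟩
    · intro z hz hzc
      have h1 := hcol z hz (by rwa [hcc])
      rintro ⟨e, he, hze⟩
      rcases Finset.mem_insert.1 he with rfl | he
      · rcases Sym2.mem_iff.1 hze with rfl | rfl
        · exact hz ⟨_, hw1, Sym2.mem_mk_right _ _⟩
        · exact hzc hcc
      · exact h1 ⟨e, Finset.mem_of_mem_erase he, hze⟩

lemma D_indep {V : Type} [Fintype V] {G : SimpleGraph V} (c : G.Coloring (Fin 2))
    {x y : V} (hx : x ∈ gallaiD G) (hy : y ∈ gallaiD G) : ¬ G.Adj x y := by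
  intro hxy
  obtain ⟨N, hN, hNn, hxN⟩ := hx
  obtain ⟨M, hM, hMn, hyM⟩ := hy
  obtain ⟨M', h1, h2, h3, -, -, h4⟩ := exchange c hM hMn _ N x rfl hN hNn hxN
  exact h4 y hyM (c.valid hxy).symm (no_aug h1 h2 hxy h3)

lemma A_matched {V : Type} [Fintype V] {G : SimpleGraph V} (c : G.Coloring (Fin 2))
    {M : Finset (Sym2 V)} (hM : IsMatchingSet G M) (hMn : M.card = nu G)
    {a b : V} (ha : a ∈ gallaiA G) (hab : s(a, b) ∈ M) : b ∈ gallaiD G := by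
  by_contra hb
  obtain ⟨haD, u, hu, hau⟩ := ha
  obtain ⟨N, hN, hNn, huN⟩ := hu
  obtain ⟨M', h1, h2, h3, -, h5, -⟩ := exchange c hM hMn _ N u rfl hN hNn huN
  have hab' : s(a, b) ∈ M' := h5 _ hab (by
    intro v hv
    rcases Sym2.mem_iff.1 hv with rfl | rfl
    · exact haD
    · exact hb)
  have hadj : G.Adj a b := h1.1 _ hab'
  have hsw := swap h1 hab' (f := s(a, u)) hau
    (fun hh => h3 ⟨_, hh, Sym2.mem_mk_right _ _⟩) (by
      intro v hv hvc
      rcases Sym2.mem_iff.1 hv with rfl | rfl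
      · exact Sym2.mem_mk_left _ _
      · exact absurd hvc h3)
  refine hb ⟨_, hsw.1, hsw.2.trans h2, ?_⟩
  rintro ⟨e, he, hbe⟩
  rcases Finset.mem_insert.1 he with rfl | he
  · rcases Sym2.mem_iff.1 hbe with h | h
    · exact hadj.ne h.symm
    · subst h
      exact h3 ⟨_, hab', Sym2.mem_mk_right _ _⟩
  · have he' := Finset.mem_erase.1 he
    exact h1.2 e he'.2 _ hab' he'.1 b hbe (Sym2.mem_mk_right _ _)

lemma nu_ge {V : Type} [Fintype V] {G : SimpleGraph V} (c : G.Coloring (Fin 2)) :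
    2 * (gallaiA G).toFinset.card + (gallaiC G).toFinset.card ≤ 2 * nu G := by
  obtain ⟨M, hM, hMn⟩ := exists_max G
  have hcov : ∀ v, v ∉ gallaiD G → v ∈ covered M := by
    intro v hv
    by_contra h
    exact hv ⟨M, hM, hMn, h⟩
  set MA := M.filter (fun e => ∃ a ∈ gallaiA G, a ∈ e) with hMA
  set MC := M.filter (fun e => ¬ ∃ a ∈ gallaiA G, a ∈ e) with hMC
  have hsum : MA.card + MC.card = M.card := Finset.card_filter_add_card_filter_not _
  have hA : (gallaiA G).toFinset.card ≤ MA.card * 1 := by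
    refine le_trans (Finset.card_le_card (t := MA.biUnion
      (fun e => e.toFinset.filter (· ∈ gallaiA G))) ?_) (Finset.card_biUnion_le_card_mul _ _ _ ?_)
    · intro a ha
      have ha := Set.mem_toFinset.1 ha
      obtain ⟨b, hb, -⟩ := cov_edge hM (hcov a ha.1)
      refine Finset.mem_biUnion.2 ⟨_, Finset.mem_filter.2 ⟨hb, a, ha, Sym2.mem_mk_left _ _⟩,
        Finset.mem_filter.2 ⟨Sym2.mem_toFinset.2 (Sym2.mem_mk_left _ _), ha⟩⟩
    · intro e he
      rw [Finset.card_le_one]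
      intro x hx y hy
      by_contra hne
      obtain ⟨hx1, hx2⟩ := Finset.mem_filter.1 hx
      obtain ⟨hy1, hy2⟩ := Finset.mem_filter.1 hy
      rw [Sym2.mem_toFinset] at hx1 hy1
      have heq : e = s(x, y) := ((Sym2.mem_and_mem_iff hne).1 ⟨hx1, hy1⟩)
      subst heq
      exact hy2.1 (A_matched c hM hMn hx2 (Finset.mem_filter.1 he).1)
  have hC : (gallaiC G).toFinset.card ≤ MC.card * 2 := by
    refine le_trans (Finset.card_le_card (t := MC.biUnion
      (fun e => e.toFinset)) ?_) (Finset.card_biUnion_le_card_mul _ _ _ ?_)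
    · intro v hv
      have hv := Set.mem_toFinset.1 hv
      obtain ⟨b, hb, -⟩ := cov_edge hM (hcov v hv.1)
      refine Finset.mem_biUnion.2 ⟨_, Finset.mem_filter.2 ⟨hb, ?_⟩,
        Sym2.mem_toFinset.2 (Sym2.mem_mk_left _ _)⟩
      rintro ⟨a, ha, hav⟩
      rcases Sym2.mem_iff.1 hav with rfl | rfl
      · exact hv.2 ha
      · exact hv.1 (A_matched c hM hMn ha (by rwa [Sym2.eq_swap]))
    · intro e he
      rw [Sym2.card_toFinset]
      split_ifs <;> omega
  omega

lemma C_edges {V : Type} [Fintype V] {G : SimpleGraph V} (hG : G.IsAcyclic) (S : Set V) :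
    (G.edgeFinset.filter (fun e => ∀ v ∈ e, v ∈ S)).card ≤ S.toFinset.card := by
  rcases S.eq_empty_or_nonempty with hS | hS
  · refine le_of_eq_of_le (Finset.card_eq_zero.2 ?_) (Nat.zero_le _)
    refine Finset.eq_empty_of_forall_notMem fun e he => ?_
    have h := (Finset.mem_filter.1 he).2
    induction e with | _ x y => exact (hS ▸ h x (Sym2.mem_mk_left _ _) : x ∈ (∅ : Set V))
  · have : Nonempty S := hS.to_subtype
    obtain ⟨T', hle, -, hT'⟩ := (SimpleGraph.connected_top (V := S)).exists_isTree_le_of_le_of_isAcyclic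
      (le_top : G.induce S ≤ ⊤) (hG.induce S)
    have h1 := hT'.card_edgeFinset
    have h2 : (G.induce S).edgeFinset.card ≤ T'.edgeFinset.card :=
      Finset.card_le_card (SimpleGraph.edgeFinset_subset_edgeFinset.2 hle)
    have h3 : (G.edgeFinset.filter (fun e => ∀ v ∈ e, v ∈ S)).card ≤
        (G.induce S).edgeFinset.card := by
      refine le_trans (Finset.card_le_card (t := (G.induce S).edgeFinset.image
        (Sym2.map Subtype.val)) ?_) Finset.card_image_le
      intro e he
      obtain ⟨he1, he2⟩ := Finset.mem_filter.1 he
      induction e with | _ x y =>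
      refine Finset.mem_image.2 ⟨s(⟨x, he2 x (Sym2.mem_mk_left _ _)⟩,
        ⟨y, he2 y (Sym2.mem_mk_right _ _)⟩), ?_, rfl⟩
      simpa using he1
    rw [Set.toFinset_card]
    have : Fintype.card S = Fintype.card ↑S := rfl
    omega

end helpers

/-- Lemma 3 of the paper. If `T ∈ 𝒯`, then `C_T = ∅`, `A_T`
is an independent set of `T`, every vertex of `A_T` has degree exactly `3` in
`T`, and `ν(T) = |A_T|`. -/
theorem statement6 {V : Type} [Fintype V] (T : SimpleGraph V) (hT : MemT T) :
    gallaiC T = ∅ ∧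
    (∀ u ∈ gallaiA T, ∀ v ∈ gallaiA T, ¬ T.Adj u v) ∧
    (∀ v ∈ gallaiA T, (T.neighborSet v).ncard = 3) ∧
    nu T = (gallaiA T).ncard := by
  classical
  obtain ⟨hTree, hdeg, hn⟩ := hT
  have c := hTree.coloringTwo
  have h1 := nu_ge c
  have h2 := C_edges hTree.isAcyclic (gallaiC T)
  have h3 := hTree.card_edgeFinset
  rw [Nat.card_eq_fintype_card] at hn
  have hdeg' : ∀ v, (T.neighborSet v).ncard = (T.incidenceFinset v).card := by
    intro v
    rw [T.card_incidenceFinset_eq_degree, ← T.card_neighborSet_eq_degree,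
      ← Nat.card_coe_set_eq, Nat.card_eq_fintype_card]
  -- key estimate
  have key : ∀ F : V → Finset (Sym2 V),
      (∀ v ∈ gallaiA T, ∀ e ∈ T.incidenceFinset v, ∃ u ∈ gallaiA T, e ∈ F u) →
      T.edgeFinset.card ≤ (∑ v ∈ (gallaiA T).toFinset, (F v).card) +
        (gallaiC T).toFinset.card := by
    intro F hF
    have hsub : T.edgeFinset ⊆ (gallaiA T).toFinset.biUnion F ∪
        T.edgeFinset.filter (fun e => ∀ v ∈ e, v ∈ gallaiC T) := by
      intro e he
      rw [Finset.mem_union]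
      by_cases hA : ∃ v ∈ gallaiA T, v ∈ e
      · left
        obtain ⟨v, hv, hve⟩ := hA
        obtain ⟨u, hu, hue⟩ := hF v hv e ((T.mem_incidenceFinset v e).2
          ⟨SimpleGraph.mem_edgeFinset.1 he, hve⟩)
        exact Finset.mem_biUnion.2 ⟨u, Set.mem_toFinset.2 hu, hue⟩
      · right
        refine Finset.mem_filter.2 ⟨he, ?_⟩
        push Not at hA
        intro v hv
        refine ⟨fun hvD => ?_, fun hvA => hA v hvA hv⟩
        obtain ⟨y, rfl⟩ := hv
        have hadj : T.Adj v y := SimpleGraph.mem_edgeFinset.1 he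
        by_cases hy : y ∈ gallaiD T
        · exact D_indep c hvD hy hadj
        · exact hA y ⟨hy, v, hvD, hadj.symm⟩ (Sym2.mem_mk_right _ _)
    calc T.edgeFinset.card ≤ _ := Finset.card_le_card hsub
      _ ≤ _ := Finset.card_union_le _ _
      _ ≤ _ := Nat.add_le_add Finset.card_biUnion_le h2
  have hsum : ∑ v ∈ (gallaiA T).toFinset, 3 = 3 * (gallaiA T).toFinset.card := by
    rw [Finset.sum_const, smul_eq_mul, mul_comm]
  have hle : ∀ v ∈ (gallaiA T).toFinset, (T.incidenceFinset v).card ≤ 3 := by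
    intro v hv
    rw [← hdeg']
    exact hdeg v (Set.mem_toFinset.1 hv)
  have k0 := key (fun v => T.incidenceFinset v) (fun v hv e he => ⟨v, hv, he⟩)
  have k1 := Finset.sum_le_sum hle
  have hC0 : (gallaiC T).toFinset.card = 0 := by omega
  have hnu : nu T = (gallaiA T).toFinset.card := by omega
  refine ⟨?_, ?_, ?_, ?_⟩
  · exact Set.toFinset_eq_empty.1 (Finset.card_eq_zero.1 hC0)
  · intro u hu v hv huv
    have k2 := key (fun x => if x = u then (T.incidenceFinset u).erase s(u, v)
      else T.incidenceFinset x) (by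
        intro x hx e he
        by_cases hxu : x = u
        · subst hxu
          by_cases hev : e = s(x, v)
          · refine ⟨v, hv, ?_⟩
            subst hev
            rw [if_neg huv.ne', SimpleGraph.mem_incidenceFinset]
            exact ⟨huv, Sym2.mem_mk_right _ _⟩
          · exact ⟨x, hx, by rw [if_pos rfl]; exact Finset.mem_erase.2 ⟨hev, he⟩⟩
        · exact ⟨x, hx, by rw [if_neg hxu]; exact he⟩)
    have hmem : s(u, v) ∈ T.incidenceFinset u := by
      rw [SimpleGraph.mem_incidenceFinset]
      exact ⟨huv, Sym2.mem_mk_left _ _⟩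
    have k3 : ∑ x ∈ (gallaiA T).toFinset, (if x = u then (T.incidenceFinset u).erase s(u, v)
      else T.incidenceFinset x).card < ∑ x ∈ (gallaiA T).toFinset, 3 := by
      apply Finset.sum_lt_sum
      · intro x hx
        split_ifs
        · exact (Finset.card_erase_le).trans (hle u (Set.mem_toFinset.2 hu))
        · exact hle x hx
      · refine ⟨u, Set.mem_toFinset.2 hu, ?_⟩
        rw [if_pos rfl]
        exact lt_of_lt_of_le (Finset.card_erase_lt_of_mem hmem) (hle u (Set.mem_toFinset.2 hu))
    omega
  · intro v hv
    by_contra hne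
    have k3 : ∑ x ∈ (gallaiA T).toFinset, (T.incidenceFinset x).card
        < ∑ x ∈ (gallaiA T).toFinset, 3 := by
      refine Finset.sum_lt_sum hle ⟨v, Set.mem_toFinset.2 hv, ?_⟩
      have := hle v (Set.mem_toFinset.2 hv)
      rw [hdeg'] at hne
      omega
    omega
  · rw [hnu, ← Set.ncard_eq_toFinset_card']

end URPaper
end

section
/- If T is a tree in 𝒯 and X ⊆ D_T with |X| = 3 such that no vertex in V(T) \ X has 3 neighbors in X, then ν(T − X) = ν(T), where T − X is the subgraph of T induced on V(T) \ X. -/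
open SimpleGraph

namespace URPaper

section helpers

/-- Matching from a pair of injections with disjoint ranges. -/
lemma matching_of_inj {W ι : Type*} [Fintype ι] (G : SimpleGraph W) (a b : ι → W)
    (ha : Function.Injective a) (hb : Function.Injective b) (hab : ∀ i j, a i ≠ b j)
    (hadj : ∀ i, G.Adj (a i) (b i)) :
    ∃ M : Finset (Sym2 W), IsMatchingSet G M ∧ M.card = Fintype.card ι ∧
      ∀ v, v ∈ covered M → (v ∈ Set.range a ∨ v ∈ Set.range b) := by
  classical
  refine ⟨Finset.univ.image (fun i => s(a i, b i)), ⟨?_, ?_⟩, ?_, ?_⟩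
  · intro e he
    simp only [Finset.mem_image, Finset.mem_univ, true_and] at he
    obtain ⟨i, rfl⟩ := he
    exact hadj i
  · intro e he f hf hne v hv hv'
    simp only [Finset.mem_image, Finset.mem_univ, true_and] at he hf
    obtain ⟨i, rfl⟩ := he
    obtain ⟨j, rfl⟩ := hf
    have hij : i ≠ j := fun h => hne (by rw [h])
    simp only [Sym2.mem_iff] at hv hv'
    rcases hv with rfl | rfl <;> rcases hv' with h | h
    · exact hij (ha h)
    · exact hab _ _ h
    · exact hab _ _ h.symm
    · exact hij (hb h)
  · rw [Finset.card_image_of_injective, Finset.card_univ]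
    intro i j h
    simp only [Sym2.eq_iff] at h
    rcases h with h | h
    · exact ha h.1
    · exact absurd h.1 (hab _ _)
  · rintro v ⟨e, he, hv⟩
    simp only [Finset.mem_image, Finset.mem_univ, true_and] at he
    obtain ⟨i, rfl⟩ := he
    simp only [Sym2.mem_iff] at hv
    rcases hv with rfl | rfl
    · exact Or.inl ⟨i, rfl⟩
    · exact Or.inr ⟨i, rfl⟩

/-- A matching injects into any vertex cover, hitting only covered vertices. -/
lemma matching_le_cover {W : Type*} (G : SimpleGraph W) (K : Finset W)
    (hK : ∀ u v, G.Adj u v → u ∈ K ∨ v ∈ K) (M : Finset (Sym2 W)) (hM : IsMatchingSet G M)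
    (K' : Finset W) (hK' : ∀ v ∈ K, v ∈ covered M → v ∈ K') :
    M.card ≤ K'.card := by
  classical
  have h : ∀ e ∈ M, ∃ v ∈ K, v ∈ e := by
    intro e he
    have := hM.1 e he
    induction e with
    | h u v =>
      rcases hK u v this with h | h
      · exact ⟨u, h, by simp⟩
      · exact ⟨v, h, by simp⟩
  rcases M.eq_empty_or_nonempty with rfl | ⟨e0, he0⟩
  · simp
  have : Nonempty W := ⟨(h e0 he0).choose⟩
  choose! c hc hce using h
  refine Finset.card_le_card_of_injOn c (fun e he => hK' _ (hc e he) ⟨e, he, hce e he⟩) ?_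
  intro e he f hf hef
  by_contra hne
  exact hM.2 e he f hf hne (c e) (hce e he) (hef ▸ hce f hf)

lemma nu_eq_of_cover {W : Type*} (G : SimpleGraph W) (K : Finset W)
    (hK : ∀ u v, G.Adj u v → u ∈ K ∨ v ∈ K) (n : ℕ) (hn : K.card ≤ n)
    (M : Finset (Sym2 W)) (hM : IsMatchingSet G M) (hMn : M.card = n) : nu G = n := by
  have hub : ∀ k ∈ {k | ∃ M : Finset (Sym2 W), IsMatchingSet G M ∧ M.card = k}, k ≤ n := by
    rintro k ⟨M', hM', rfl⟩
    exact (matching_le_cover G K hK M' hM' K (fun _ h _ => h)).trans hn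
  apply le_antisymm
  · exact csSup_le ⟨n, M, hM, hMn⟩ hub
  · exact le_csSup ⟨n, hub⟩ ⟨M, hM, hMn⟩

/-- Number of edges of an acyclic graph inside a nonempty set. -/
lemma edges_inside {V : Type} [Fintype V] [DecidableEq V] (T : SimpleGraph V) (hT : T.IsAcyclic)
    (W : Finset V) (hW : W.Nonempty) (E : Finset (Sym2 V))
    (hE : ∀ e ∈ E, e ∈ T.edgeSet ∧ ∀ v ∈ e, v ∈ W) : E.card + 1 ≤ W.card := by
  classical
  have hac : (T.induce (W : Set V)).IsAcyclic := hT.induce _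
  have : Nonempty (W : Set V) := hW.to_subtype
  obtain ⟨F, hF, -, hFt⟩ : ∃ F : SimpleGraph (W : Set V), T.induce (W : Set V) ≤ F ∧ F ≤ ⊤ ∧ F.IsTree := by
    obtain ⟨F, h⟩ := (SimpleGraph.connected_top (V := (W : Set V))).exists_isTree_le_of_le_of_isAcyclic
      (le_top : T.induce (W : Set V) ≤ ⊤) hac
    exact ⟨F, by tauto⟩
  have h1 := hFt.card_edgeFinset
  have h2 : Fintype.card (W : Set V) = W.card := by simp
  have h3 : E ⊆ F.edgeFinset.image (Sym2.map Subtype.val) := by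
    intro e he
    obtain ⟨h4, h5⟩ := hE e he
    induction e with
    | h u v =>
      refine Finset.mem_image.2 ⟨s(⟨u, h5 u (by simp)⟩, ⟨v, h5 v (by simp)⟩), ?_, by simp⟩
      rw [SimpleGraph.mem_edgeFinset]
      exact hF (by simpa using h4)
  have h4 := (Finset.card_le_card h3).trans Finset.card_image_le
  omega

/-- Global edge count. -/
lemma edge_count {V : Type} [Fintype V] [DecidableEq V] (T : SimpleGraph V) (hT : T.IsTree)
    (B W : Finset V) (hB : ∀ v ∈ B, (T.neighborSet v).ncard ≤ 3) (hW : W.Nonempty)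
    (h : ∀ u v, T.Adj u v → u ∉ B → v ∉ B → u ∈ W) :
    Fintype.card V ≤ 3 * B.card + W.card := by
  classical
  have h1 := hT.card_edgeFinset
  let E := T.edgeFinset.filter (fun e => ∀ v ∈ e, v ∉ B)
  have h2 : E.card + 1 ≤ W.card := by
    apply edges_inside T hT.isAcyclic W hW
    intro e he
    simp only [E, Finset.mem_filter, SimpleGraph.mem_edgeFinset] at he
    refine ⟨he.1, ?_⟩
    obtain ⟨he1, he2⟩ := he
    induction e with
    | h u v =>
      have hu := he2 u (by simp)
      have hv := he2 v (by simp)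
      intro w hw
      rcases Sym2.mem_iff.1 hw with rfl | rfl
      · exact h _ _ he1 hu hv
      · exact h _ _ (T.adj_symm he1) hv hu
  have h3 : T.edgeFinset ⊆ E ∪ B.biUnion (fun v => T.incidenceFinset v) := by
    intro e he
    by_cases hb : ∀ v ∈ e, v ∉ B
    · exact Finset.mem_union_left _ (Finset.mem_filter.2 ⟨he, hb⟩)
    · push Not at hb
      obtain ⟨v, hv, hvB⟩ := hb
      refine Finset.mem_union_right _ (Finset.mem_biUnion.2 ⟨v, hvB, ?_⟩)
      rw [SimpleGraph.mem_incidenceFinset]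
      exact ⟨SimpleGraph.mem_edgeFinset.1 he, hv⟩
  have h4 : (B.biUnion (fun v => T.incidenceFinset v)).card ≤ B.card * 3 := by
    apply Finset.card_biUnion_le_card_mul
    intro v hv
    have := hB v hv
    rw [SimpleGraph.card_incidenceFinset_eq_degree]
    rwa [Set.ncard_eq_toFinset_card', ← SimpleGraph.neighborFinset_def] at this
  have h5 := (Finset.card_le_card h3).trans (Finset.card_union_le _ _)
  omega

/-- Hall in a convenient form. -/
lemma hall_form {V : Type} [Fintype V] [DecidableEq V] (T : SimpleGraph V)
    (K : Finset V) (P : V → Prop)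
    (h : ∀ S ⊆ K, ∀ N : Finset V, (∀ v, v ∈ N ↔ P v ∧ ∃ s ∈ S, T.Adj s v) → S.card ≤ N.card) :
    ∃ f : K → V, Function.Injective f ∧ ∀ k : K, T.Adj k (f k) ∧ P (f k) := by
  classical
  let t : K → Finset V := fun k => Finset.univ.filter (fun v => T.Adj k v ∧ P v)
  obtain ⟨f, hf, hf'⟩ := (Finset.all_card_le_biUnion_card_iff_exists_injective t).1 (by
    intro s
    have := h (s.image Subtype.val) (by
      intro v hv
      obtain ⟨w, -, rfl⟩ := Finset.mem_image.1 hv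
      exact w.2) (s.biUnion t) (by
        intro v
        simp only [t, Finset.mem_biUnion, Finset.mem_filter, Finset.mem_univ, true_and,
          Finset.mem_image]
        constructor
        · rintro ⟨a, ha, h1, h2⟩
          exact ⟨h2, a, ⟨a, ha, rfl⟩, h1⟩
        · rintro ⟨h2, _, ⟨a, ha, rfl⟩, h1⟩
          exact ⟨a, ha, h1, h2⟩)
    rwa [Finset.card_image_of_injective _ Subtype.val_injective] at this)
  refine ⟨f, hf, fun k => ?_⟩
  simpa [t] using hf' k

/-- Koenig. -/
lemma koenig {V : Type} [Fintype V] [DecidableEq V] (T : SimpleGraph V) (c : V → Bool)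
    (hc : ∀ u v, T.Adj u v → c u ≠ c v) :
    ∃ K : Finset V, (∀ u v, T.Adj u v → u ∈ K ∨ v ∈ K) ∧
      ∃ f : K → V, Function.Injective f ∧ ∀ k : K, T.Adj k (f k) ∧ f k ∉ K := by
  classical
  let Cov : Finset V → Prop := fun K => ∀ u v, T.Adj u v → u ∈ K ∨ v ∈ K
  obtain ⟨K, hK, hmin⟩ := Finset.exists_min_image (Finset.univ.filter Cov) Finset.card
    ⟨Finset.univ, by simp [Cov]⟩
  simp only [Finset.mem_filter, Finset.mem_univ, true_and] at hK hmin
  refine ⟨K, hK, ?_⟩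
  have key : ∀ b : Bool, ∃ f : (K.filter (fun v => c v = b) : Finset V) → V,
      Function.Injective f ∧ ∀ k : (K.filter (fun v => c v = b) : Finset V), T.Adj k (f k) ∧ f k ∉ K := by
    intro b
    apply hall_form T (K.filter (fun v => c v = b)) (fun v => v ∉ K)
    intro S hS N hN
    have hSK : S ⊆ K := hS.trans (Finset.filter_subset _ _)
    have hcov : Cov ((K \ S) ∪ N) := by
      have aux : ∀ u v, T.Adj u v → u ∈ K → u ∈ K \ S ∪ N ∨ v ∈ K \ S ∪ N := by
        intro u v huv hu
        by_cases huS : u ∈ S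
        · right
          by_cases hv : v ∈ K
          · refine Finset.mem_union_left _ (Finset.mem_sdiff.2 ⟨hv, fun hvS => ?_⟩)
            have h1 := (Finset.mem_filter.1 (hS huS)).2
            have h2 := (Finset.mem_filter.1 (hS hvS)).2
            exact hc u v huv (h1.trans h2.symm)
          · exact Finset.mem_union_right _ ((hN v).2 ⟨hv, u, huS, huv⟩)
        · left
          exact Finset.mem_union_left _ (Finset.mem_sdiff.2 ⟨hu, huS⟩)
      intro u v huv
      rcases hK u v huv with h | h
      · exact aux u v huv h
      · exact (aux v u huv.symm h).symm
    have h1 := hmin _ hcov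
    have h2 := Finset.card_union_le (K \ S) N
    have h3 := Finset.card_sdiff_add_card_eq_card hSK
    omega
  choose f hf hf' using key
  refine ⟨fun k => f (c k) ⟨k, by simp⟩, ?_, fun k => hf' (c k) ⟨k, by simp⟩⟩
  intro k l hkl
  have h1 := (hf' (c k) ⟨k, by simp⟩).1
  have h2 := (hf' (c l) ⟨l, by simp⟩).1
  have h3 := hc _ _ h1
  have h4 := hc _ _ h2
  simp only at hkl h3 h4
  rw [hkl] at h3
  have h5 : c k = c l := by
    revert h3 h4
    generalize c (f (c l) _) = x
    cases c k <;> cases c l <;> cases x <;> simp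
  have h6 : ∀ (b b' : Bool) (hb : b = b') (x : V) (hx : x ∈ K.filter (fun v => c v = b))
      (y : V) (hy : y ∈ K.filter (fun v => c v = b')), f b ⟨x, hx⟩ = f b' ⟨y, hy⟩ → x = y := by
    rintro b _ rfl x hx y hy h
    exact congrArg Subtype.val (hf b h)
  exact Subtype.ext (h6 _ _ h5 _ _ _ _ hkl)

end helpers

/-- Lemma 4 (ii) of the paper. If `T ∈ 𝒯` and `X ⊆ D_T` with
`|X| = 3` such that no vertex in `V(T) \ X` has `3` neighbors in `X`, then
`ν(T - X) = ν(T)`. -/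
theorem statement8 {V : Type} [Fintype V] (T : SimpleGraph V) (hT : MemT T)
    (X : Set V) (hXD : X ⊆ gallaiD T) (hcard : X.ncard = 3)
    (hno3 : ∀ v ∉ X, (T.neighborSet v ∩ X).ncard < 3) :
    nu (T.induce Xᶜ) = nu T := by
  classical
  obtain ⟨hTree, hdeg, hcardV⟩ := hT
  obtain ⟨c⟩ := hTree.colorable_two
  obtain ⟨K, hK, f, hf, hf'⟩ := koenig T (fun v => decide (c v = 0)) (by
    intro u v huv h
    have h1 := c.valid huv
    apply h1
    have h2 : c u = 0 ↔ c v = 0 := by simpa using h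
    generalize c u = x at *
    generalize c v = y at *
    fin_cases x <;> fin_cases y <;> simp_all)
  -- matchings of T from injections
  have mk : ∀ g : K → V, Function.Injective g → (∀ k : K, T.Adj k (g k) ∧ g k ∉ K) →
      ∃ M : Finset (Sym2 V), IsMatchingSet T M ∧ M.card = K.card ∧
        ∀ v, v ∈ covered M → (v ∈ K ∨ v ∈ Set.range g) := by
    intro g hg hg'
    obtain ⟨M, h1, h2, h3⟩ := matching_of_inj T (fun k : K => (k : V)) g Subtype.val_injective hg
      (fun i j h => (hg' j).2 (h ▸ i.2)) (fun k => (hg' k).1)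
    refine ⟨M, h1, by simpa using h2, fun v hv => ?_⟩
    rcases h3 v hv with h | h
    · obtain ⟨k, rfl⟩ := h
      exact Or.inl k.2
    · exact Or.inr h
  have hnu : nu T = K.card := by
    obtain ⟨M, h1, h2, -⟩ := mk f hf hf'
    exact nu_eq_of_cover T K hK _ le_rfl M h1 h2
  have hKD : ∀ k ∈ K, k ∉ gallaiD T := by
    rintro k hk ⟨M, h1, h2, h3⟩
    have h4 := matching_le_cover T K hK M h1 (K.erase k)
      (fun v hv hc => Finset.mem_erase.2 ⟨fun h => h3 (h ▸ hc), hv⟩)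
    have h5 := Finset.card_erase_lt_of_mem hk
    omega
  let D' : V → Prop := fun i => i ∉ K ∧ ∃ g : K → V, Function.Injective g ∧
    (∀ k : K, T.Adj k (g k) ∧ g k ∉ K) ∧ i ∉ Set.range g
  have hD' : ∀ i, D' i → i ∈ gallaiD T := by
    rintro i ⟨hi, g, hg, hg', hir⟩
    obtain ⟨M, h1, h2, h3⟩ := mk g hg hg'
    refine ⟨M, h1, h2.trans hnu.symm, fun hc => ?_⟩
    rcases h3 i hc with h | h
    · exact hi h
    · exact hir h
  let K' := K.filter (fun k => ∀ v, T.Adj k v → ¬ D' v)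
  let I' : Finset V := Finset.univ.filter (fun i => i ∉ K ∧ ¬ D' i)
  -- I' is matched into K'
  have hmatch : ∀ i ∈ I', ∃ k : K, f k = i ∧ (k : V) ∈ K' := by
    intro i hi
    simp only [I', Finset.mem_filter, Finset.mem_univ, true_and] at hi
    obtain ⟨hiK, hiD⟩ := hi
    have hviol : ∃ S ⊆ K, ∃ N : Finset V, (∀ v, v ∈ N ↔ (v ∉ K ∧ v ≠ i) ∧ ∃ s ∈ S, T.Adj s v) ∧
        N.card < S.card := by
      by_contra hcon
      push Not at hcon
      obtain ⟨g, hg, hg'⟩ := hall_form T K (fun v => v ∉ K ∧ v ≠ i)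
        (fun S hS N hN => hcon S hS N hN)
      exact hiD ⟨hiK, g, hg, fun k => ⟨(hg' k).1, (hg' k).2.1⟩, by
        rintro ⟨k, hk⟩
        exact (hg' k).2.2 hk⟩
    obtain ⟨S, hS, N, hN, hlt⟩ := hviol
    -- every saturating injection g maps S onto insert i N
    have honto : ∀ g : K → V, Function.Injective g → (∀ k : K, T.Adj k (g k) ∧ g k ∉ K) →
        ∀ v ∈ insert i N, ∃ k : K, (k : V) ∈ S ∧ g k = v := by
      intro g hg hg'
      let SK : Finset K := Finset.univ.filter (fun k => (k : V) ∈ S)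
      have hSK : SK.card = S.card := by
        have : SK.image Subtype.val = S := by
          ext v
          simp only [SK, Finset.mem_image, Finset.mem_filter, Finset.mem_univ, true_and]
          constructor
          · rintro ⟨k, hk, rfl⟩
            exact hk
          · intro hv
            exact ⟨⟨v, hS hv⟩, hv, rfl⟩
        rw [← this, Finset.card_image_of_injective _ Subtype.val_injective]
      have hsub : SK.image g ⊆ insert i N := by
        intro v hv
        obtain ⟨k, hk, rfl⟩ := Finset.mem_image.1 hv
        by_cases h : g k = i
        · rw [h]; exact Finset.mem_insert_self _ _
        · exact Finset.mem_insert_of_mem ((hN _).2 ⟨⟨(hg' k).2, h⟩, k,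
            (Finset.mem_filter.1 hk).2, (hg' k).1⟩)
      have heq : SK.image g = insert i N := by
        apply Finset.eq_of_subset_of_card_le hsub
        rw [Finset.card_image_of_injective _ hg, hSK]
        exact (Finset.card_insert_le _ _).trans hlt
      intro v hv
      rw [← heq] at hv
      obtain ⟨k, hk, rfl⟩ := Finset.mem_image.1 hv
      exact ⟨k, (Finset.mem_filter.1 hk).2, rfl⟩
    obtain ⟨k, hkS, hki⟩ := honto f hf hf' i (Finset.mem_insert_self _ _)
    refine ⟨k, hki, Finset.mem_filter.2 ⟨k.2, ?_⟩⟩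
    rintro v hkv ⟨hvK, g, hg, hg', hvr⟩
    have hv : v ∈ insert i N := by
      by_cases h : v = i
      · rw [h]; exact Finset.mem_insert_self _ _
      · exact Finset.mem_insert_of_mem ((hN _).2 ⟨⟨hvK, h⟩, k, hkS, hkv⟩)
    obtain ⟨l, -, hl⟩ := honto g hg hg' v hv
    exact hvr ⟨l, hl⟩
  have hI'K' : I'.card ≤ K'.card := by
    by_cases hne : I'.Nonempty
    · have : Nonempty K := ⟨(hmatch _ hne.choose_spec).choose⟩
      choose! p hp hp' using hmatch
      refine Finset.card_le_card_of_injOn (fun i => ((p i : K) : V)) (fun i hi => hp' i hi) ?_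
      intro i hi j hj hij
      have : p i = p j := Subtype.ext hij
      rw [← hp i hi, ← hp j hj, this]
    · rw [Finset.not_nonempty_iff_eq_empty.1 hne]; simp
  have hcardV' : 3 * K.card + 1 = Fintype.card V := by
    rw [← hnu, hcardV, Nat.card_eq_fintype_card]
  have hKA : ∀ k ∈ K, k ∉ K' → (T.neighborSet k).ncard ≤ 3 := by
    intro k hk hk'
    apply hdeg
    refine ⟨hKD k hk, ?_⟩
    by_contra hcon
    push Not at hcon
    exact hk' (Finset.mem_filter.2 ⟨hk, fun v hv hD => hcon v (hD' v hD) hv⟩)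
  have hK'K : K' ⊆ K := Finset.filter_subset _ _
  have hK'e : ¬ K'.Nonempty := by
    intro hne
    have h1 := edge_count T hTree (K \ K') (K' ∪ I')
      (fun v hv => hKA v (Finset.mem_sdiff.1 hv).1 (Finset.mem_sdiff.1 hv).2)
      (hne.mono Finset.subset_union_left) (by
        intro u v huv hu hv
        by_cases huK : u ∈ K
        · by_cases huK' : u ∈ K'
          · exact Finset.mem_union_left _ huK'
          · exact absurd (Finset.mem_sdiff.2 ⟨huK, huK'⟩) hu
        · have hvK : v ∈ K := (hK u v huv).resolve_left huK
          have hvK' : v ∈ K' := by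
            by_contra h
            exact hv (Finset.mem_sdiff.2 ⟨hvK, h⟩)
          refine Finset.mem_union_right _ (Finset.mem_filter.2 ⟨Finset.mem_univ _, huK, ?_⟩)
          exact (Finset.mem_filter.1 hvK').2 u huv.symm)
    have h2 := Finset.card_union_le K' I'
    have h3 := Finset.card_sdiff_add_card_eq_card hK'K
    have h4 := hne.card_pos
    omega
  have hdeg3 : ∀ k ∈ K, (T.neighborSet k).ncard ≤ 3 :=
    fun k hk => hKA k hk (fun h => hK'e ⟨k, h⟩)
  -- expansion
  have hexp : ∀ S ⊆ K, S.Nonempty → ∀ N : Finset V,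
      (∀ v, v ∉ K → (∃ s ∈ S, T.Adj s v) → v ∈ N) → 2 * S.card + 1 ≤ N.card := by
    intro S hS hne N hN
    have h1 := edge_count T hTree (K \ S) (S ∪ N)
      (fun v hv => hdeg3 v (Finset.mem_sdiff.1 hv).1)
      (hne.mono Finset.subset_union_left) (by
        intro u v huv hu hv
        by_cases huK : u ∈ K
        · by_cases huS : u ∈ S
          · exact Finset.mem_union_left _ huS
          · exact absurd (Finset.mem_sdiff.2 ⟨huK, huS⟩) hu
        · have hvK : v ∈ K := (hK u v huv).resolve_left huK
          have hvS : v ∈ S := by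
            by_contra h
            exact hv (Finset.mem_sdiff.2 ⟨hvK, h⟩)
          exact Finset.mem_union_right _ (hN u huK ⟨v, hvS, huv.symm⟩))
    have h2 := Finset.card_union_le S N
    have h3 := Finset.card_sdiff_add_card_eq_card hS
    omega
  have hXK : ∀ k ∈ K, k ∉ X := fun k hk hx => hKD k hk (hXD hx)
  obtain ⟨g, hg, hg'⟩ := hall_form T K (fun v => v ∉ K ∧ v ∉ X) (by
    intro S hS N hN
    rcases S.eq_empty_or_nonempty with rfl | hne
    · simp
    by_cases h1 : S.card = 1
    · obtain ⟨s, rfl⟩ := Finset.card_eq_one.1 h1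
      have h2 := hexp {s} hS hne (N ∪ (T.neighborSet s ∩ X).toFinset) (by
        rintro v hv ⟨s', hs', hadj⟩
        rw [Finset.mem_singleton.1 hs'] at hadj
        by_cases hvX : v ∈ X
        · refine Finset.mem_union_right _ ?_
          rw [Set.mem_toFinset]
          exact ⟨hadj, hvX⟩
        · exact Finset.mem_union_left _ ((hN v).2 ⟨⟨hv, hvX⟩, s, by simp, hadj⟩))
      have h3 := hno3 s (hXK s (hS (by simp)))
      rw [Set.ncard_eq_toFinset_card'] at h3
      have h4 := Finset.card_union_le N (T.neighborSet s ∩ X).toFinset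
      omega
    · have h2 := hexp S hS hne (N ∪ X.toFinset) (by
        rintro v hv hs
        by_cases hvX : v ∈ X
        · exact Finset.mem_union_right _ (by simpa using hvX)
        · exact Finset.mem_union_left _ ((hN v).2 ⟨⟨hv, hvX⟩, hs⟩))
      have h3 := hcard
      rw [Set.ncard_eq_toFinset_card'] at h3
      have h4 := Finset.card_union_le N X.toFinset
      have h5 := hne.card_pos
      omega)
  obtain ⟨M, hM, hMc, -⟩ := matching_of_inj (T.induce Xᶜ)
    (fun k : K => (⟨k, hXK k k.2⟩ : (Xᶜ : Set V))) (fun k : K => ⟨g k, (hg' k).2.2⟩)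
    (fun a b h => Subtype.ext (Subtype.mk.inj h))
    (fun a b h => hg (Subtype.mk.inj h))
    (fun i j h => (hg' j).2.1 (by
      have h1 : (i : V) = g j := congrArg Subtype.val h
      rw [← h1]; exact i.2))
    (fun k => (hg' k).1)
  rw [hnu]
  refine nu_eq_of_cover (T.induce Xᶜ) (K.subtype (fun v => v ∈ Xᶜ)) ?_ _ ?_ M hM (by simpa using hMc)
  · intro u v huv
    simpa using hK u v huv
  · rw [Finset.card_subtype]
    exact Finset.card_filter_le _ _

end URPaper
end

section
/- Every graph G in 𝒢 satisfies ν_ur(G) = (n(G) − 1)/3. -/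
open SimpleGraph

namespace URPaper

section General

variable {V : Type*}

lemma match_unique {G : SimpleGraph V} {M : Finset (Sym2 V)} (h : IsMatchingSet G M)
    {e f : Sym2 V} (he : e ∈ M) (hf : f ∈ M) {v : V} (hv : v ∈ e) (hv' : v ∈ f) : e = f := by
  by_contra hne
  exact h.2 e he f hf hne v hv hv'

lemma cover_bound {M : Finset (Sym2 V)}
    (h : ∀ e ∈ M, ∀ f ∈ M, e ≠ f → ∀ v : V, v ∈ e → v ∉ f)
    (Y Y' : Finset V) (hY : ∀ e ∈ M, ∃ y ∈ Y, y ∈ e)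
    (hY' : ∀ y ∈ Y, y ∈ covered M → y ∈ Y') : M.card ≤ Y'.card := by
  rcases isEmpty_or_nonempty V with hV | hV
  · have : M = ∅ := by
      rw [Finset.eq_empty_iff_forall_notMem]
      intro e
      induction e with
      | _ a b => exact hV.elim a
    simp [this]
  choose! g hg using hY
  refine Finset.card_le_card_of_injOn g ?_ ?_
  · intro e he
    exact hY' _ (hg e he).1 ⟨e, he, (hg e he).2⟩
  · intro e he f hf hef
    by_contra hne
    exact h e he f hf hne (g e) (hg e he).2 (hef ▸ (hg f hf).2)

lemma stop_lemma [Finite V] {G : SimpleGraph V} {M : Finset (Sym2 V)} (hM : IsURMatching G M)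
    (F : Set V) (hne : F.Nonempty) (hcov : ∀ y ∈ F, y ∈ covered M)
    (hF : ∀ y ∈ F, ∀ x, G.Adj y x → x ∉ F ∧ ∃ y' ∈ F, y' ≠ y ∧ G.Adj y' x) : False := by
  classical
  have h1 : ∀ y ∈ F, ∃ m y', s(y, m) ∈ M ∧ m ∉ F ∧ y' ∈ F ∧ y' ≠ y ∧ G.Adj y' m := by
    intro y hy
    obtain ⟨e, he, hye⟩ := hcov y hy
    obtain ⟨m, rfl⟩ := hye
    have hadj : G.Adj y m := hM.1.1 _ he
    obtain ⟨h2, y', h3, h4, h5⟩ := hF y hy m hadj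
    exact ⟨m, y', he, h2, h3, h4, h5⟩
  choose! m g hm hmF hgF hgne hgadj using h1
  let f : V → V := fun y => if y ∈ F then g y else y
  have fF : ∀ y ∈ F, f y = g y := fun y hy => by simp [f, hy]
  have fN : ∀ y, y ∉ F → f y = y := fun y hy => by simp [f, hy]
  have fFF : ∀ y ∈ F, f y ∈ F := fun y hy => by rw [fF y hy]; exact hgF y hy
  let P := Function.periodicPts f
  have hbij : Set.BijOn f P P := Function.bijOn_periodicPts f
  let σ : V → V := fun y => if y ∈ P then f y else y
  have σP : ∀ y ∈ P, σ y = f y := fun y hy => by simp [σ, hy]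
  have σN : ∀ y, y ∉ P → σ y = y := fun y hy => by simp [σ, hy]
  have σF : ∀ y, y ∉ F → σ y = y := by
    intro y hy
    by_cases h : y ∈ P
    · rw [σP y h, fN y hy]
    · exact σN y h
  have σFF : ∀ y ∈ F, σ y ∈ F := by
    intro y hy
    by_cases h : y ∈ P
    · rw [σP y h]; exact fFF y hy
    · rw [σN y h]; exact hy
  have σinj : Function.Injective σ := by
    intro x y hxy
    by_cases hx : x ∈ P <;> by_cases hy : y ∈ P
    · rw [σP x hx, σP y hy] at hxy
      exact hbij.injOn hx hy hxy
    · rw [σP x hx, σN y hy] at hxy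
      exact absurd (hxy ▸ hbij.mapsTo hx) hy
    · rw [σN x hx, σP y hy] at hxy
      exact absurd (hxy ▸ hbij.mapsTo hy) hx
    · rwa [σN x hx, σN y hy] at hxy
  have σsurj : Function.Surjective σ := Finite.surjective_of_injective σinj
  obtain ⟨y0, hy0⟩ := hne
  have hit : ∀ i, f^[i] y0 ∈ F := by
    intro i
    induction i with
    | zero => exact hy0
    | succ i ih => rw [Function.iterate_succ_apply']; exact fFF _ ih
  obtain ⟨i, j, hij, hEq⟩ := Finite.exists_ne_map_eq_of_infinite (fun i : ℕ => f^[i] y0)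
  have hper : ∃ y ∈ F, y ∈ P := by
    wlog hlt : i < j generalizing i j
    · exact this j i hij.symm hEq.symm (by omega)
    refine ⟨f^[i] y0, hit i, ?_⟩
    refine Function.mk_mem_periodicPts (n := j - i) (by omega) ?_
    change f^[j-i] (f^[i] y0) = f^[i] y0
    rw [← Function.iterate_add_apply]
    have : j - i + i = j := by omega
    rw [this]; exact hEq.symm
  obtain ⟨y, hyF, hyP⟩ := hper
  have mate : ∀ e ∈ M, ∀ y ∈ F, y ∈ e → e = s(y, m y) := by
    intro e he y hy hye
    exact match_unique hM.1 he (hm y hy) hye (by simp)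
  have key := hM.2 (M.image (Sym2.map σ)) ⟨?_, ?_⟩ ?_
  · have : s(σ y, m y) ∈ M := by
      rw [← key]
      refine Finset.mem_image.2 ⟨_, hm y hyF, ?_⟩
      rw [Sym2.map_mk, σF (m y) (hmF y hyF)]
    have h2 := match_unique hM.1 this (hm y hyF) (v := m y) (by simp) (by simp)
    have h3 : σ y = y := by
      rw [Sym2.eq_iff] at h2
      rcases h2 with h | h
      · exact h.1
      · rw [h.1, h.2]
    rw [σP y hyP, fF y hyF] at h3
    exact hgne y hyF h3
  · intro e he
    obtain ⟨e', he', rfl⟩ := Finset.mem_image.1 he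
    by_cases h : ∃ y ∈ F, y ∈ e'
    · obtain ⟨y, hy, hye⟩ := h
      rw [mate e' he' y hy hye, Sym2.map_mk, σF (m y) (hmF y hy)]
      by_cases hp : y ∈ P
      · rw [σP y hp, fF y hy]; exact hgadj y hy
      · rw [σN y hp]; exact hM.1.1 _ (hm y hy)
    · have : Sym2.map σ e' = e' := by
        induction e' with
        | _ a b =>
          rw [Sym2.map_mk, σF a (fun hh => h ⟨a, hh, by simp⟩), σF b (fun hh => h ⟨b, hh, by simp⟩)]
      rw [this]; exact hM.1.1 _ he'
  · intro e he e2 he2 hne v hv hv2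
    obtain ⟨e', he', rfl⟩ := Finset.mem_image.1 he
    obtain ⟨e2', he2', rfl⟩ := Finset.mem_image.1 he2
    obtain ⟨a, ha, rfl⟩ := Sym2.mem_map.1 hv
    obtain ⟨b, hb, hab⟩ := Sym2.mem_map.1 hv2
    obtain rfl := σinj hab
    exact hne (by rw [match_unique hM.1 he' he2' ha hb])
  · ext v
    constructor
    · rintro ⟨e, he, hv⟩
      obtain ⟨e', he', rfl⟩ := Finset.mem_image.1 he
      obtain ⟨a, ha, rfl⟩ := Sym2.mem_map.1 hv
      by_cases h : a ∈ F
      · exact hcov _ (σFF a h)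
      · rw [σF a h]; exact ⟨e', he', ha⟩
    · intro hv
      obtain ⟨u, rfl⟩ := σsurj v
      have hu : u ∈ covered M := by
        by_cases h : u ∈ F
        · exact hcov _ h
        · rwa [σF u h] at hv
      obtain ⟨e, he, hue⟩ := hu
      exact ⟨_, Finset.mem_image_of_mem _ he, Sym2.mem_map.2 ⟨u, hue, rfl⟩⟩

/-- A subset of a uniquely restricted matching is uniquely restricted in subgraphs. -/
lemma ur_subset {G G' : SimpleGraph V} (hle : G' ≤ G) {M N : Finset (Sym2 V)}
    (hM : IsURMatching G M) (hN : N ⊆ M) (hN' : ∀ e ∈ N, e ∈ G'.edgeSet) :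
    IsURMatching G' N := by
  classical
  refine ⟨⟨hN', fun e he f hf => hM.1.2 e (hN he) f (hN hf)⟩, ?_⟩
  intro M' hM' hcov
  have hc : ∀ v, (∃ e ∈ M', v ∈ e) ↔ ∃ e ∈ N, v ∈ e := fun v => Set.ext_iff.1 hcov v
  have key := hM.2 (M' ∪ (M \ N)) ⟨?_, ?_⟩ ?_
  · have hsub : M' ⊆ M := by rw [← key]; exact Finset.subset_union_left
    ext e
    induction e with
    | _ a b =>
      constructor
      · intro he
        obtain ⟨f, hf, haf⟩ := (hc a).1 ⟨_, he, by simp⟩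
        rwa [match_unique hM.1 (hsub he) (hN hf) (v := a) (by simp) haf]
      · intro he
        obtain ⟨f, hf, haf⟩ := (hc a).2 ⟨_, he, by simp⟩
        rwa [match_unique hM.1 (hN he) (hsub hf) (v := a) (by simp) haf]
  · intro e he
    rcases Finset.mem_union.1 he with h | h
    · exact (SimpleGraph.edgeSet_mono hle) (hM'.1 e h)
    · exact hM.1.1 e (Finset.mem_sdiff.1 h).1
  · have aux : ∀ e ∈ M', ∀ f ∈ M \ N, ∀ v, v ∈ e → v ∈ f → False := by
      intro e he f hf v hv hv'
      obtain ⟨g, hg, hvg⟩ := (hc v).1 ⟨e, he, hv⟩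
      have := match_unique hM.1 (hN hg) (Finset.mem_sdiff.1 hf).1 hvg hv'
      exact (Finset.mem_sdiff.1 hf).2 (this ▸ hg)
    intro e he f hf hne v hv hv'
    rcases Finset.mem_union.1 he with h | h <;> rcases Finset.mem_union.1 hf with h' | h'
    · exact hM'.2 e h f h' hne v hv hv'
    · exact aux e h f h' v hv hv'
    · exact aux f h' e h v hv' hv
    · exact hM.1.2 e (Finset.mem_sdiff.1 h).1 f (Finset.mem_sdiff.1 h').1 hne v hv hv'
  · ext v
    constructor
    · rintro ⟨e, he, hv⟩
      rcases Finset.mem_union.1 he with h | h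
      · obtain ⟨g, hg, hvg⟩ := (hc v).1 ⟨e, h, hv⟩
        exact ⟨g, hN hg, hvg⟩
      · exact ⟨e, (Finset.mem_sdiff.1 h).1, hv⟩
    · rintro ⟨e, he, hv⟩
      by_cases h : e ∈ N
      · obtain ⟨g, hg, hvg⟩ := (hc v).2 ⟨e, h, hv⟩
        exact ⟨g, Finset.mem_union_left _ hg, hvg⟩
      · exact ⟨e, Finset.mem_union_right _ (Finset.mem_sdiff.2 ⟨he, h⟩), hv⟩

lemma parity [Finite V] {G : SimpleGraph V} {M : Finset (Sym2 V)} (hM : IsMatchingSet G M)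
    (B : Set V) {a b : V} (ha : a ∈ B) (hb : b ∉ B)
    (h : ∀ c d, G.Adj c d → c ∈ B → d ∉ B → s(c, d) = s(a, b)) :
    s(a, b) ∈ M ↔ Odd (covered M ∩ B).ncard := by
  classical
  have := Fintype.ofFinite V
  let t : Sym2 V → Finset V := fun e => Finset.univ.filter (fun v => v ∈ e ∧ v ∈ B)
  have h1 : covered M ∩ B = ((M.biUnion t : Finset V) : Set V) := by
    ext v
    simp [covered, t]
    grind
  have h2 : (covered M ∩ B).ncard = ∑ e ∈ M, (t e).card := by
    rw [h1, Set.ncard_coe_finset, Finset.card_biUnion]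
    intro e he f hf hne
    change Disjoint (t e) (t f)
    rw [Finset.disjoint_left]
    intro v hv hv'
    simp [t] at hv hv'
    exact hM.2 e he f hf hne v hv.1 hv'.1
  have h3 : ∀ e ∈ M, e ≠ s(a, b) → Even (t e).card := by
    intro e he hne
    have hadj := hM.1 e he
    induction e with
    | _ c d =>
      have hcd : G.Adj c d := hadj
      have hcB : c ∈ B ↔ d ∈ B := by
        constructor
        · intro hc
          by_contra hd
          exact hne (h c d hcd hc hd)
        · intro hc
          by_contra hd
          exact hne (Sym2.eq_swap.trans (h d c hcd.symm hc hd))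
      by_cases hc : c ∈ B
      · have : t s(c, d) = {c, d} := by
          ext v; simp [t]; grind
        rw [this, Finset.card_pair hcd.ne]
        exact even_two
      · have : t s(c, d) = ∅ := by
          ext v; simp [t]; grind
        rw [this]; simp
  have h4 : (t s(a, b)).card = 1 := by
    have : t s(a, b) = {a} := by
      ext v; simp [t]; grind
    rw [this]; simp
  rw [h2]
  by_cases hm : s(a, b) ∈ M
  · rw [← Finset.add_sum_erase _ _ hm, h4]
    simp only [hm, true_iff]
    refine Even.one_add (Finset.even_sum _ ?_)
    intro e he
    exact h3 e (Finset.mem_of_mem_erase he) (Finset.ne_of_mem_erase he)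
  · simp only [hm, false_iff, Nat.not_odd_iff_even]
    refine Finset.even_sum _ ?_
    intro e he
    exact h3 e he (fun hh => hm (hh ▸ he))

lemma exists_leaf [Finite V] {G : SimpleGraph V} (hG : G.IsAcyclic) {a b : V} (hab : G.Adj a b) :
    ∃ x y, G.Adj x y ∧ ∀ z, G.Adj x z → z = y := by
  classical
  have := Fintype.ofFinite V
  let c := G.connectedComponentMk a
  have ht := hG.isTree_connectedComponent c
  have : Nontrivial c.supp := by
    refine ⟨⟨a, by simp [c]⟩, ⟨b, ?_⟩, ?_⟩
    · simp [c]; exact hab.symm.reachable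
    · intro h; exact hab.ne (congrArg Subtype.val h)
  obtain ⟨x, hx⟩ := ht.exists_vert_degree_one_of_nontrivial
  rw [SimpleGraph.degree_eq_one_iff_existsUnique_adj] at hx
  obtain ⟨y, hy, hu⟩ := hx
  refine ⟨x, y, hy, ?_⟩
  intro z hz
  have hzc : z ∈ c.supp := by
    have hx2 : (x : V) ∈ c.supp := x.2
    rw [SimpleGraph.ConnectedComponent.mem_supp_iff] at hx2 ⊢
    rw [← hx2]
    exact SimpleGraph.ConnectedComponent.sound hz.symm.reachable
  exact congrArg Subtype.val (hu ⟨z, hzc⟩ hz)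

lemma konig [Fintype V] (n : ℕ) : ∀ (G : SimpleGraph V), G.IsAcyclic → G.edgeSet.ncard = n →
    ∃ (K : Finset V) (M : Finset (Sym2 V)), (∀ a b, G.Adj a b → a ∈ K ∨ b ∈ K) ∧
      IsMatchingSet G M ∧ K.card ≤ M.card := by
  classical
  induction n using Nat.strong_induction_on with
  | _ n ih =>
    intro G hG hn
    by_cases hE : ∃ a b, G.Adj a b
    swap
    · push Not at hE
      exact ⟨∅, ∅, fun a b h => absurd h (hE a b), ⟨by simp, by simp⟩, by simp⟩
    obtain ⟨a, b, hab⟩ := hE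
    obtain ⟨x, y, hxy, hu⟩ := exists_leaf hG hab
    let G' : SimpleGraph V := G.deleteEdges {e | y ∈ e}
    have hle : G' ≤ G := SimpleGraph.deleteEdges_le _
    have hadj : ∀ c d, G'.Adj c d ↔ G.Adj c d ∧ c ≠ y ∧ d ≠ y := by
      intro c d
      simp [G', SimpleGraph.deleteEdges_adj]
      grind
    have hlt : G'.edgeSet.ncard < n := by
      rw [← hn]
      refine Set.ncard_lt_ncard ?_ (Set.toFinite _)
      refine ⟨SimpleGraph.edgeSet_mono hle, fun h => ?_⟩
      have := h (show s(x, y) ∈ G.edgeSet from hxy)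
      exact ((hadj x y).1 this).2.2 rfl
    obtain ⟨K, M, hK, hM, hc⟩ := ih _ hlt G' (hG.anti hle) rfl
    have hno : ∀ e ∈ M, x ∉ e ∧ y ∉ e := by
      intro e he
      have := hM.1 e he
      induction e with
      | _ c d =>
        have h1 := (hadj c d).1 this
        simp only [Sym2.mem_iff, not_or]
        refine ⟨⟨?_, ?_⟩, ?_, ?_⟩
        · rintro rfl; exact h1.2.2 (hu d h1.1)
        · rintro rfl; exact h1.2.1 (hu c h1.1.symm)
        · exact h1.2.1.symm
        · exact h1.2.2.symm
    refine ⟨insert y K, insert s(x, y) M, ?_, ⟨?_, ?_⟩, ?_⟩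
    · intro c d hcd
      by_cases h1 : c = y
      · simp [h1]
      by_cases h2 : d = y
      · simp [h2]
      rcases hK c d ((hadj c d).2 ⟨hcd, h1, h2⟩) with h | h <;> simp [h]
    · intro e he
      rcases Finset.mem_insert.1 he with rfl | h
      · exact hxy
      · exact SimpleGraph.edgeSet_mono hle (hM.1 e h)
    · intro e he f hf hne v hv hv'
      rcases Finset.mem_insert.1 he with rfl | h <;> rcases Finset.mem_insert.1 hf with rfl | h'
      · exact hne rfl
      · have := hno f h'
        rcases Sym2.mem_iff.1 hv with rfl | rfl <;> tauto
      · have := hno e h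
        rcases Sym2.mem_iff.1 hv' with rfl | rfl <;> tauto
      · exact hM.2 e h f h' hne v hv hv'
    · rw [Finset.card_insert_of_notMem (s := M)]
      · exact (Finset.card_insert_le _ _).trans (by omega)
      · intro h; exact (hno _ h).2 (by simp)

lemma le_nu [Finite V] {G : SimpleGraph V} {M : Finset (Sym2 V)} (hM : IsMatchingSet G M) :
    M.card ≤ nu G := by
  have := Fintype.ofFinite V
  refine le_csSup ⟨Fintype.card (Sym2 V), ?_⟩ ⟨M, hM, rfl⟩
  rintro k ⟨N, _, rfl⟩
  exact Finset.card_le_univ N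

lemma exists_nu [Finite V] (G : SimpleGraph V) :
    ∃ M : Finset (Sym2 V), IsMatchingSet G M ∧ M.card = nu G := by
  have := Fintype.ofFinite V
  refine Nat.sSup_mem (s := {k | ∃ M : Finset (Sym2 V), IsMatchingSet G M ∧ M.card = k})
    ⟨0, ∅, ⟨by simp, by simp⟩, rfl⟩ ⟨Fintype.card (Sym2 V), ?_⟩
  rintro k ⟨N, _, rfl⟩
  exact Finset.card_le_univ N

lemma exists_cover [Fintype V] {G : SimpleGraph V} (hG : G.IsAcyclic) :
    ∃ K : Finset V, (∀ a b, G.Adj a b → a ∈ K ∨ b ∈ K) ∧ K.card = nu G ∧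
      ∀ v ∈ K, v ∉ gallaiD G := by
  classical
  obtain ⟨K, M, hK, hM, hc⟩ := konig _ G hG rfl
  have hcov : ∀ N, IsMatchingSet G N → ∀ e ∈ N, ∃ y ∈ K, y ∈ e := by
    intro N hN e he
    have := hN.1 e he
    induction e with
    | _ a b =>
      rcases hK a b this with h | h
      · exact ⟨a, h, by simp⟩
      · exact ⟨b, h, by simp⟩
  obtain ⟨N, hN, hNc⟩ := exists_nu G
  have hle : nu G ≤ K.card := hNc ▸ cover_bound hN.2 K K (hcov N hN) (fun y hy _ => hy)
  have heq : K.card = nu G := le_antisymm (hc.trans (le_nu hM)) hle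
  refine ⟨K, hK, heq, ?_⟩
  rintro v hv ⟨L, hL, hLc, hLv⟩
  have := cover_bound hL.2 K (K.erase v) (hcov L hL) (fun y hy hyc =>
    Finset.mem_erase.2 ⟨fun h => hLv (h ▸ hyc), hy⟩)
  rw [Finset.card_erase_of_mem hv] at this
  have := Finset.card_pos.2 ⟨v, hv⟩
  omega

end General

section Cert

/-- Adjacency in the graph with edge list `L`. -/
def adjB {n : ℕ} (L : List (Fin n × Fin n)) (i j : Fin n) : Bool :=
  L.any fun p => (p.1 == i && p.2 == j) || (p.1 == j && p.2 == i)

/-- No set of at most `t` elements meets all lists in `Fs`. -/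
def hitB {n : ℕ} : ℕ → List (List (Fin n)) → Bool
  | 0, Fs => !Fs.isEmpty
  | _ + 1, [] => false
  | t + 1, F :: Fs => F.all fun z => hitB t ((F :: Fs).filter fun F' => !F'.contains z)

/-- Every vertex outside of `F` has zero or at least two neighbors in `F`, and `F` is independent. -/
def stopB {n : ℕ} (L : List (Fin n × Fin n)) (F : List (Fin n)) : Bool :=
  L.all fun p =>
    (!F.contains p.1 || (!F.contains p.2 && F.any fun c => c != p.1 && adjB L c p.2)) &&
    (!F.contains p.2 || (!F.contains p.1 && F.any fun c => c != p.2 && adjB L c p.1))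

/-- Elimination order certificate. -/
def elimB {n : ℕ} (L : List (Fin n × Fin n)) : List (Fin n × Fin n) → Bool
  | [] => true
  | p :: ps => adjB L p.1 p.2 && (ps.all fun q => !adjB L p.1 q.1 && !adjB L p.1 q.2 &&
      p.1 != q.1 && p.1 != q.2 && p.2 != q.1 && p.2 != q.2) && elimB L ps

/-- The full certificate. -/
def certB {n : ℕ} (L : List (Fin n × Fin n)) (Y : List (Fin n)) (k : ℕ)
    (Fs : List (List (Fin n))) (Ms : List (List (Fin n × Fin n))) : Bool :=
  (L.all fun p => p.1 != p.2) &&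
  (L.all fun p => Y.contains p.1 || Y.contains p.2) &&
  (Fs.all fun F => !F.isEmpty && (F.all fun y => Y.contains y) && stopB L F) &&
  hitB (Y.length - (k + 1)) Fs &&
  (Ms.all fun P => P.length == k && elimB L P) &&
  ((List.finRange n).all fun w => Ms.any fun P => P.all fun p => p.1 != w && p.2 != w)

/-- The relevant properties of the graphs in the family. -/
def Good {X : Type} (H : SimpleGraph X) (k : ℕ) : Prop :=
  (∀ M, IsURMatching H M → M.card ≤ k) ∧
  ∀ w, ∃ M, IsURMatching H M ∧ M.card = k ∧ w ∉ covered M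

lemma hitB_sound {n : ℕ} (t : ℕ) : ∀ (Fs : List (List (Fin n))), hitB t Fs = true →
    ∀ Z : Finset (Fin n), Z.card ≤ t → ∃ F ∈ Fs, ∀ z ∈ F, z ∉ Z := by
  induction t with
  | zero =>
    intro Fs h Z hZ
    have : Z = ∅ := by simpa using hZ
    subst this
    cases Fs with
    | nil => simp [hitB] at h
    | cons F Fs => exact ⟨F, by simp, by simp⟩
  | succ t ih =>
    intro Fs h Z hZ
    cases Fs with
    | nil => simp [hitB] at h
    | cons F Fs =>
      by_cases hF : ∀ z ∈ F, z ∉ Z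
      · exact ⟨F, by simp, hF⟩
      push Not at hF
      obtain ⟨z, hzF, hzZ⟩ := hF
      rw [hitB, List.all_eq_true] at h
      obtain ⟨F', hF', hd⟩ := ih _ (h z hzF) (Z.erase z) (by
        rw [Finset.card_erase_of_mem hzZ]; omega)
      rw [List.mem_filter] at hF'
      refine ⟨F', hF'.1, fun z' hz' hzz => ?_⟩
      by_cases he : z' = z
      · subst he
        simp [hz'] at hF'
      · exact hd z' hz' (Finset.mem_erase.2 ⟨he, hzz⟩)

lemma adjB_iff {n : ℕ} {L : List (Fin n × Fin n)} {i j : Fin n} :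
    adjB L i j = true ↔ (i, j) ∈ L ∨ (j, i) ∈ L := by
  simp only [adjB, List.any_eq_true, Bool.or_eq_true, Bool.and_eq_true, beq_iff_eq]
  constructor
  · rintro ⟨⟨a, b⟩, h, ⟨rfl, rfl⟩ | ⟨rfl, rfl⟩⟩ <;> simp_all
  · rintro (h | h)
    · exact ⟨_, h, Or.inl ⟨rfl, rfl⟩⟩
    · exact ⟨_, h, Or.inr ⟨rfl, rfl⟩⟩

lemma elimB_sound {n : ℕ} {G : SimpleGraph (Fin n)} {L : List (Fin n × Fin n)}
    (hG : ∀ i j, G.Adj i j ↔ adjB L i j = true) (P : List (Fin n × Fin n)) :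
    elimB L P = true → ∃ M, IsURMatching G M ∧ M.card = P.length ∧
      ∀ v, v ∈ covered M ↔ ∃ p ∈ P, v = p.1 ∨ v = p.2 := by
  induction P with
  | nil =>
    intro _
    refine ⟨∅, ⟨⟨by simp, by simp⟩, ?_⟩, by simp, by simp [covered]⟩
    intro M' _ h
    rw [Finset.eq_empty_iff_forall_notMem]
    intro e he
    induction e with
    | _ a b =>
      have : a ∈ covered M' := ⟨_, he, by simp⟩
      rw [h] at this
      simp [covered] at this
  | cons p ps ih =>
    obtain ⟨x, y⟩ := p
    intro h
    simp only [elimB, Bool.and_eq_true, List.all_eq_true, Bool.not_eq_true', bne_iff_ne] at h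
    obtain ⟨⟨hxy, hps⟩, h2⟩ := h
    obtain ⟨M, hM, hc, hcov⟩ := ih h2
    have hadj : G.Adj x y := (hG x y).2 hxy
    have hx : ∀ v ∈ covered M, v ≠ x ∧ v ≠ y ∧ ¬ G.Adj x v := by
      intro v hv
      obtain ⟨q, hq, hv⟩ := (hcov v).1 hv
      have := hps q hq
      rw [hG]
      obtain ⟨⟨⟨⟨⟨q1, q2⟩, q3⟩, q4⟩, q5⟩, q6⟩ := this
      rcases hv with rfl | rfl
      · exact ⟨Ne.symm q3, Ne.symm q5, by simp [q1]⟩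
      · exact ⟨Ne.symm q4, Ne.symm q6, by simp [q2]⟩
    have hno : ∀ e ∈ M, x ∉ e ∧ y ∉ e := by
      intro e he
      exact ⟨fun h => (hx x ⟨e, he, h⟩).1 rfl, fun h => (hx y ⟨e, he, h⟩).2.1 rfl⟩
    have hcov' : ∀ v, v ∈ covered (insert s(x, y) M) ↔ v = x ∨ v = y ∨ v ∈ covered M := by
      intro v
      simp [covered, or_assoc]
    have hmat : IsMatchingSet G (insert s(x, y) M) := by
      constructor
      · intro e he
        rcases Finset.mem_insert.1 he with rfl | h
        · exact hadj
        · exact hM.1.1 e h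
      · intro e he f hf hne v hv hv'
        rcases Finset.mem_insert.1 he with rfl | h <;> rcases Finset.mem_insert.1 hf with rfl | h'
        · exact hne rfl
        · have := hno f h'
          rcases Sym2.mem_iff.1 hv with rfl | rfl <;> tauto
        · have := hno e h
          rcases Sym2.mem_iff.1 hv' with rfl | rfl <;> tauto
        · exact hM.1.2 e h f h' hne v hv hv'
    refine ⟨insert s(x, y) M, ⟨hmat, ?_⟩, ?_, ?_⟩
    · intro M' hM' hcc
      have hcc' : ∀ v, v ∈ covered M' ↔ v = x ∨ v = y ∨ v ∈ covered M := by
        intro v; rw [hcc, hcov']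
      have hxy' : s(x, y) ∈ M' := by
        obtain ⟨e, he, hxe⟩ := (hcc' x).2 (Or.inl rfl)
        obtain ⟨z, rfl⟩ := hxe
        have hxz : G.Adj x z := hM'.1 _ he
        rcases (hcc' z).1 ⟨_, he, by simp⟩ with rfl | rfl | h
        · exact absurd hxz (G.irrefl)
        · exact he
        · exact absurd hxz (hx z h).2.2
      have hE : M'.erase s(x, y) = M := by
        refine hM.2 _ ⟨fun e he => hM'.1 e (Finset.mem_of_mem_erase he), fun e he f hf =>
          hM'.2 e (Finset.mem_of_mem_erase he) f (Finset.mem_of_mem_erase hf)⟩ ?_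
        ext v
        constructor
        · rintro ⟨e, he, hv⟩
          have h1 := Finset.mem_of_mem_erase he
          have h2 := Finset.ne_of_mem_erase he
          rcases (hcc' v).1 ⟨e, h1, hv⟩ with rfl | rfl | h
          · exact absurd (match_unique hM' h1 hxy' hv (by simp)) h2
          · exact absurd (match_unique hM' h1 hxy' hv (by simp)) h2
          · exact h
        · intro hv
          obtain ⟨e, he, hve⟩ := (hcc' v).2 (Or.inr (Or.inr hv))
          refine ⟨e, Finset.mem_erase.2 ⟨?_, he⟩, hve⟩
          rintro rfl
          have := hx v hv
          rcases Sym2.mem_iff.1 hve with rfl | rfl <;> tauto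
      rw [← hE, Finset.insert_erase hxy']
    · rw [Finset.card_insert_of_notMem (fun h => (hno _ h).1 (by simp)), hc, List.length_cons]
    · intro v
      rw [hcov', hcov]
      simp [or_assoc]

lemma certB_sound {n : ℕ} {G : SimpleGraph (Fin n)} {L : List (Fin n × Fin n)}
    {Y : List (Fin n)} {k : ℕ} {Fs : List (List (Fin n))} {Ms : List (List (Fin n × Fin n))}
    (hGL : G = SimpleGraph.fromEdgeSet {e | e ∈ L.map (fun p => s(p.1, p.2))})
    (h : certB L Y k Fs Ms = true) : Good G k := by
  simp only [certB, Bool.and_eq_true] at h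
  obtain ⟨⟨⟨⟨⟨hL, hY⟩, hFs⟩, hH⟩, hMs⟩, hw⟩ := h
  rw [List.all_eq_true] at hL hY hFs hMs hw
  have hG : ∀ i j, G.Adj i j ↔ adjB L i j = true := by
    intro i j
    have h1 : s(i, j) ∈ L.map (fun p => s(p.1, p.2)) ↔ ((i, j) ∈ L ∨ (j, i) ∈ L) := by
      rw [List.mem_map]
      constructor
      · rintro ⟨⟨a, b⟩, hp, he⟩
        rcases Sym2.eq_iff.1 he with ⟨rfl, rfl⟩ | ⟨rfl, rfl⟩
        · exact Or.inl hp
        · exact Or.inr hp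
      · rintro (h | h)
        · exact ⟨_, h, rfl⟩
        · exact ⟨_, h, Sym2.eq_swap⟩
    rw [hGL, SimpleGraph.fromEdgeSet_adj, Set.mem_ofPred_eq, h1, adjB_iff, and_iff_left_iff_imp]
    rintro (h | h) rfl <;> simpa using hL _ h
  constructor
  · intro M hM
    by_contra hlt
    push Not at hlt
    have hcov : ∀ e ∈ M, ∃ y ∈ Y.toFinset, y ∈ e := by
      intro e he
      have hadj := hM.1.1 e he
      induction e with
      | _ a b =>
        have hadj : G.Adj a b := hadj
        rw [hG, adjB_iff] at hadj
        rcases hadj with h | h <;> have := hY _ h <;>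
          simp only [Bool.or_eq_true, List.contains_iff_mem] at this <;>
          rcases this with h | h <;> refine ⟨_, List.mem_toFinset.2 h, by simp⟩
    classical
    have h1 := cover_bound hM.1.2 Y.toFinset
      (Y.toFinset.filter (fun y => y ∈ covered M)) hcov (fun y hy hc => by simp_all)
    have h2 := Finset.card_filter_add_card_filter_not (s := Y.toFinset) (fun y => y ∈ covered M)
    have h3 := List.toFinset_card_le Y
    obtain ⟨F, hF, hd⟩ := hitB_sound _ _ hH
      (Y.toFinset.filter (fun y => ¬ y ∈ covered M)) (by omega)
    have h4 := hFs F hF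
    simp only [Bool.and_eq_true, List.all_eq_true, List.contains_iff_mem] at h4
    obtain ⟨⟨h5, h6⟩, h7⟩ := h4
    refine stop_lemma hM {y | y ∈ F} ?_ ?_ ?_
    · cases F with
      | nil => simp at h5
      | cons a F => exact ⟨a, by simp⟩
    · intro y hy
      by_contra hc
      exact hd y hy (by simp [h6 y hy, hc])
    · intro y hy x hyx
      rw [stopB, List.all_eq_true] at h7
      rw [hG, adjB_iff] at hyx
      have hy' : y ∈ F := hy
      rcases hyx with h | h
      · have := (Bool.and_eq_true _ _ ▸ h7 _ h).1
        simp only [hy', Bool.or_eq_true, Bool.and_eq_true, Bool.not_eq_true',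
          List.any_eq_true, bne_iff_ne, ← Bool.not_eq_true, List.contains_iff_mem, not_true,
          false_or] at this
        obtain ⟨h8, c, hc, hcy, hcx⟩ := this
        exact ⟨h8, c, hc, hcy, (hG _ _).2 hcx⟩
      · have := (Bool.and_eq_true _ _ ▸ h7 _ h).2
        simp only [hy', Bool.or_eq_true, Bool.and_eq_true, Bool.not_eq_true',
          List.any_eq_true, bne_iff_ne, ← Bool.not_eq_true, List.contains_iff_mem, not_true,
          false_or] at this
        obtain ⟨h8, c, hc, hcy, hcx⟩ := this
        exact ⟨h8, c, hc, hcy, (hG _ _).2 hcx⟩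
  · intro w
    have := hw w (List.mem_finRange w)
    rw [List.any_eq_true] at this
    obtain ⟨P, hP, hPw⟩ := this
    have hPM := hMs P hP
    simp only [Bool.and_eq_true, beq_iff_eq] at hPM
    obtain ⟨M, hM, hc, hcov⟩ := elimB_sound hG P hPM.2
    refine ⟨M, hM, hc.trans hPM.1, ?_⟩
    rw [hcov]
    rintro ⟨p, hp, h⟩
    rw [List.all_eq_true] at hPw
    have := hPw p hp
    simp only [Bool.and_eq_true, bne_iff_ne] at this
    rcases h with rfl | rfl <;> simp at this

lemma good1 : Good BG1 3 := by
  refine certB_sound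
    (L := [(0, 4), (1, 4), (0, 5), (2, 5), (0, 6), (3, 6), (1, 7), (2, 7), (1, 8), (3, 8), (2, 9), (3, 9)])
    (Y := [0, 1, 2, 3])
    (Fs := [[0, 1, 2, 3]])
    (Ms := [[(4, 1), (7, 2), (9, 3)], [(5, 0), (6, 3), (8, 1)], [(7, 2), (8, 3), (6, 0)], [(6, 0), (5, 2), (7, 1)]])
    ?_ (by decide +kernel)
  unfold BG1
  congr 1
  ext e
  simp only [List.map_cons, List.map_nil, List.mem_cons, List.not_mem_nil, or_false,
    Set.mem_insert_iff, Set.mem_singleton_iff, Set.mem_ofPred_eq]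

lemma good2 : Good BG2 4 := by
  refine certB_sound
    (L := [(0, 4), (1, 4), (0, 5), (2, 5), (0, 6), (3, 6), (1, 7), (2, 7), (1, 8), (3, 8), (2, 9), (3, 9), (10, 6), (10, 7), (11, 8), (11, 5), (12, 4), (12, 9)])
    (Y := [4, 5, 6, 7, 8, 9])
    (Fs := [[4, 5, 8, 9], [4, 6, 7, 9], [5, 6, 7, 8]])
    (Ms := [[(0, 6), (12, 9), (2, 7), (11, 8)], [(10, 6), (3, 8), (1, 4), (0, 5)], [(11, 5), (3, 9), (10, 7), (12, 4)]])
    ?_ (by decide +kernel)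
  unfold BG2
  congr 1
  ext e
  simp only [List.map_cons, List.map_nil, List.mem_cons, List.not_mem_nil, or_false,
    Set.mem_insert_iff, Set.mem_singleton_iff, Set.mem_ofPred_eq]

lemma good3 : Good BG3 5 := by
  refine certB_sound
    (L := [(0, 1), (1, 2), (2, 3), (3, 4), (4, 5), (5, 0), (6, 7), (7, 8), (8, 9), (9, 10), (10, 11), (11, 6), (12, 0), (12, 6), (13, 2), (13, 8), (14, 4), (14, 10), (15, 12), (15, 13), (15, 14)])
    (Y := [0, 2, 4, 6, 8, 10, 15])
    (Fs := [[0, 2, 4, 15], [6, 8, 10, 15], [0, 2, 4, 6, 8, 10]])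
    (Ms := [[(12, 15), (5, 4), (3, 2), (7, 8), (9, 10)], [(13, 2), (1, 0), (12, 6), (11, 10), (14, 4)], [(1, 0), (5, 4), (11, 6), (7, 8), (13, 15)], [(11, 10), (14, 15), (5, 0), (7, 8), (13, 2)]])
    ?_ (by decide +kernel)
  unfold BG3
  congr 1
  ext e
  simp only [List.map_cons, List.map_nil, List.mem_cons, List.not_mem_nil, or_false,
    Set.mem_insert_iff, Set.mem_singleton_iff, Set.mem_ofPred_eq]

lemma good4 : Good BG4 6 := by
  refine certB_sound
    (L := [(0, 1), (1, 2), (2, 3), (3, 4), (4, 5), (5, 0), (6, 7), (7, 8), (8, 9), (9, 10), (10, 11), (11, 6), (12, 0), (13, 1), (14, 2), (15, 3), (16, 4), (17, 5), (12, 6), (13, 7), (14, 8), (15, 9), (16, 10), (17, 11), (18, 12), (18, 14), (18, 16)])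
    (Y := [1, 3, 5, 7, 9, 11, 12, 14, 16])
    (Fs := [[1, 7, 12, 14], [3, 9, 14, 16], [5, 11, 12, 16], [1, 3, 5, 7, 9, 11], [1, 3, 7, 9, 12, 16], [1, 5, 7, 11, 14, 16], [3, 5, 9, 11, 12, 14]])
    (Ms := [[(13, 7), (17, 11), (4, 16), (15, 9), (2, 14), (6, 12)], [(10, 11), (18, 12), (8, 7), (13, 1), (0, 5), (2, 3)], [(8, 14), (6, 12), (15, 3), (17, 5), (18, 16), (0, 1)], [(0, 5), (2, 14), (13, 7), (18, 16), (6, 11), (15, 9)]])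
    ?_ (by decide +kernel)
  unfold BG4
  congr 1
  ext e
  simp only [List.map_cons, List.map_nil, List.mem_cons, List.not_mem_nil, or_false,
    Set.mem_insert_iff, Set.mem_singleton_iff, Set.mem_ofPred_eq]

lemma good5 : Good BG5 5 := by
  refine certB_sound
    (L := [(0, 4), (1, 4), (0, 5), (2, 5), (0, 6), (3, 6), (1, 7), (2, 7), (1, 8), (3, 8), (2, 9), (3, 9), (10, 6), (10, 7), (11, 8), (11, 5), (12, 4), (12, 9), (13, 14), (14, 15), (13, 10), (13, 11), (15, 12)])
    (Y := [0, 1, 2, 3, 10, 11, 12, 14])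
    (Fs := [[0, 1, 2, 3], [0, 1, 10, 11], [2, 3, 10, 11], [0, 2, 10, 12, 14], [0, 3, 11, 12, 14], [1, 2, 11, 12, 14], [1, 3, 10, 12, 14]])
    (Ms := [[(4, 12), (5, 11), (9, 3), (6, 10), (13, 14)], [(8, 1), (7, 2), (13, 14), (6, 0), (15, 12)], [(15, 12), (4, 1), (5, 11), (7, 10), (9, 3)], [(15, 14), (9, 3), (5, 11), (13, 10), (8, 1)]])
    ?_ (by decide +kernel)
  unfold BG5
  congr 1
  ext e
  simp only [List.map_cons, List.map_nil, List.mem_cons, List.not_mem_nil, or_false,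
    Set.mem_insert_iff, Set.mem_singleton_iff, Set.mem_ofPred_eq]

lemma good6 : Good BG6 6 := by
  refine certB_sound
    (L := [(0, 4), (1, 4), (0, 5), (2, 5), (0, 6), (3, 6), (1, 7), (2, 7), (1, 8), (3, 8), (2, 9), (3, 9), (10, 6), (10, 7), (11, 8), (11, 5), (12, 4), (12, 9), (13, 14), (14, 15), (15, 16), (16, 17), (17, 18), (18, 13), (13, 10), (15, 11), (17, 12)])
    (Y := [4, 5, 6, 7, 8, 9, 13, 15, 17])
    (Fs := [[4, 5, 8, 9], [4, 6, 7, 9], [5, 6, 7, 8], [4, 5, 7, 13, 15, 17], [4, 6, 8, 13, 15, 17], [5, 6, 9, 13, 15, 17], [7, 8, 9, 13, 15, 17]])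
    (Ms := [[(1, 8), (2, 9), (0, 6), (12, 17), (16, 15), (10, 13)], [(14, 13), (18, 17), (3, 9), (12, 4), (11, 5), (10, 7)], [(2, 7), (14, 15), (11, 8), (16, 17), (1, 4), (0, 6)], [(0, 6), (16, 15), (18, 13), (11, 8), (1, 7), (3, 9)]])
    ?_ (by decide +kernel)
  unfold BG6
  congr 1
  ext e
  simp only [List.map_cons, List.map_nil, List.mem_cons, List.not_mem_nil, or_false,
    Set.mem_insert_iff, Set.mem_singleton_iff, Set.mem_ofPred_eq]

lemma good7 : Good BG7 6 := by
  refine certB_sound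
    (L := [(0, 1), (1, 2), (2, 3), (3, 4), (4, 5), (5, 0), (6, 7), (7, 8), (8, 9), (9, 10), (10, 11), (11, 6), (12, 0), (12, 6), (13, 2), (13, 8), (14, 4), (14, 10), (15, 12), (15, 13), (15, 14), (17, 16), (16, 18), (17, 9), (17, 5), (18, 3), (18, 11)])
    (Y := [0, 2, 4, 6, 8, 10, 15, 17, 18])
    (Fs := [[0, 2, 4, 15], [4, 10, 17, 18], [6, 8, 10, 15], [0, 2, 4, 6, 8, 10], [0, 2, 6, 8, 17, 18], [0, 2, 10, 15, 17, 18], [4, 6, 8, 15, 17, 18]])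
    (Ms := [[(12, 15), (7, 8), (13, 2), (5, 17), (16, 18), (11, 10)], [(1, 0), (12, 6), (13, 8), (14, 4), (3, 18), (9, 17)], [(7, 6), (9, 10), (16, 18), (14, 4), (5, 0), (3, 2)], [(11, 10), (1, 2), (12, 15), (16, 17), (3, 4), (7, 8)]])
    ?_ (by decide +kernel)
  unfold BG7
  congr 1
  ext e
  simp only [List.map_cons, List.map_nil, List.mem_cons, List.not_mem_nil, or_false,
    Set.mem_insert_iff, Set.mem_singleton_iff, Set.mem_ofPred_eq]

lemma good8 : Good BG8 7 := by
  refine certB_sound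
    (L := [(0, 1), (1, 2), (2, 3), (3, 4), (4, 5), (5, 0), (6, 7), (7, 8), (8, 9), (9, 10), (10, 11), (11, 6), (12, 0), (13, 1), (14, 2), (15, 3), (16, 4), (17, 5), (12, 6), (13, 7), (14, 8), (15, 9), (16, 10), (17, 11), (18, 12), (18, 14), (18, 16), (19, 20), (20, 21), (19, 13), (19, 15), (21, 17)])
    (Y := [0, 2, 4, 6, 8, 10, 13, 15, 17, 18, 20])
    (Fs := [[0, 2, 4, 18], [2, 8, 13, 15], [6, 8, 10, 18], [0, 6, 13, 17, 20], [4, 10, 15, 17, 20], [0, 2, 4, 6, 8, 10], [0, 4, 6, 10, 13, 15], [0, 4, 8, 13, 15, 18], [2, 6, 10, 13, 15, 18], [0, 2, 6, 8, 15, 17, 20], [0, 2, 10, 15, 17, 18, 20], [0, 8, 10, 13, 17, 18, 20], [2, 4, 6, 13, 17, 18, 20], [2, 4, 8, 10, 13, 17, 20], [4, 6, 8, 15, 17, 18, 20]])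
    (Ms := [[(3, 15), (12, 18), (1, 13), (16, 10), (14, 8), (11, 17), (21, 20)], [(19, 15), (21, 17), (7, 6), (9, 10), (14, 2), (1, 0), (5, 4)], [(9, 8), (5, 4), (3, 2), (11, 6), (7, 13), (16, 18), (19, 20)]])
    ?_ (by decide +kernel)
  unfold BG8
  congr 1
  ext e
  simp only [List.map_cons, List.map_nil, List.mem_cons, List.not_mem_nil, or_false,
    Set.mem_insert_iff, Set.mem_singleton_iff, Set.mem_ofPred_eq]

lemma good9 : Good BG9 8 := by
  refine certB_sound
    (L := [(0, 1), (1, 2), (2, 3), (3, 4), (4, 5), (5, 0), (6, 7), (7, 8), (8, 9), (9, 10), (10, 11), (11, 6), (12, 0), (13, 1), (14, 2), (15, 3), (16, 4), (17, 5), (12, 6), (13, 7), (14, 8), (15, 9), (16, 10), (17, 11), (18, 12), (18, 14), (18, 16), (19, 20), (20, 21), (21, 22), (22, 23), (23, 24), (24, 19), (19, 13), (21, 15), (23, 17)])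
    (Y := [1, 3, 5, 7, 9, 11, 12, 14, 16, 19, 21, 23])
    (Fs := [[1, 7, 12, 14], [3, 9, 14, 16], [5, 11, 12, 16], [1, 3, 5, 7, 9, 11], [1, 3, 5, 19, 21, 23], [1, 3, 7, 9, 12, 16], [1, 5, 7, 11, 14, 16], [3, 5, 9, 11, 12, 14], [7, 9, 11, 19, 21, 23], [1, 3, 11, 12, 16, 19, 21, 23], [1, 5, 9, 14, 16, 19, 21, 23], [1, 9, 11, 12, 14, 19, 21, 23], [3, 5, 7, 12, 14, 19, 21, 23], [3, 7, 11, 14, 16, 19, 21, 23], [5, 7, 9, 12, 16, 19, 21, 23]])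
    (Ms := [[(0, 12), (4, 16), (6, 11), (10, 9), (18, 14), (13, 19), (24, 23), (15, 21)], [(22, 23), (17, 5), (6, 7), (18, 16), (8, 9), (15, 3), (20, 19), (2, 1)], [(24, 19), (22, 21), (13, 7), (8, 14), (2, 3), (4, 5), (10, 11), (0, 12)], [(2, 14), (4, 16), (18, 12), (20, 21), (24, 23), (15, 9), (13, 7), (10, 11)]])
    ?_ (by decide +kernel)
  unfold BG9
  congr 1
  ext e
  simp only [List.map_cons, List.map_nil, List.mem_cons, List.not_mem_nil, or_false,
    Set.mem_insert_iff, Set.mem_singleton_iff, Set.mem_ofPred_eq]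

end Cert

section Main

lemma good_map {X W : Type} [Nonempty X] {H : SimpleGraph X} (φ : X → W)
    (hφ : Function.Injective φ) {k : ℕ} (hg : Good H k) {K : SimpleGraph W}
    (hK : ∀ a b, K.Adj a b ↔ ∃ x y, H.Adj x y ∧ φ x = a ∧ φ y = b) : Good K k := by
  classical
  have hinj : Function.Injective (Sym2.map φ) := Sym2.map.injective hφ
  have hA : ∀ M, IsMatchingSet H M → IsMatchingSet K (M.image (Sym2.map φ)) := by
    intro M hM
    constructor
    · intro e he
      obtain ⟨e', he', rfl⟩ := Finset.mem_image.1 he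
      have := hM.1 e' he'
      induction e' with
      | _ a b => exact (hK _ _).2 ⟨a, b, this, rfl, rfl⟩
    · intro e he e2 he2 hne v hv hv2
      obtain ⟨e', he', rfl⟩ := Finset.mem_image.1 he
      obtain ⟨e2', he2', rfl⟩ := Finset.mem_image.1 he2
      obtain ⟨a, ha, rfl⟩ := Sym2.mem_map.1 hv
      obtain ⟨b, hb, hab⟩ := Sym2.mem_map.1 hv2
      obtain rfl := hφ hab
      exact hne (by rw [match_unique hM he' he2' ha hb])
  have hB : ∀ N, IsMatchingSet K N → ∃ M, IsMatchingSet H M ∧ M.image (Sym2.map φ) = N := by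
    intro N hN
    have him : (N.preimage (Sym2.map φ) hinj.injOn).image (Sym2.map φ) = N := by
      ext e
      simp only [Finset.mem_image, Finset.mem_preimage]
      constructor
      · rintro ⟨e', h, rfl⟩; exact h
      · intro he
        have := hN.1 e he
        induction e with
        | _ a b =>
          obtain ⟨x, y, hxy, rfl, rfl⟩ := (hK a b).1 this
          exact ⟨s(x, y), he, rfl⟩
    refine ⟨N.preimage (Sym2.map φ) hinj.injOn, ⟨?_, ?_⟩, him⟩
    · intro e he
      have := hN.1 _ (Finset.mem_preimage.1 he)
      induction e with
      | _ a b =>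
        obtain ⟨x, y, hxy, h1, h2⟩ := (hK _ _).1 this
        rw [← hφ h1, ← hφ h2]; exact hxy
    · intro e he f hf hne v hv hv'
      exact hN.2 _ (Finset.mem_preimage.1 he) _ (Finset.mem_preimage.1 hf)
        (fun h => hne (hinj h)) (φ v) (Sym2.mem_map.2 ⟨v, hv, rfl⟩) (Sym2.mem_map.2 ⟨v, hv', rfl⟩)
  have hC : ∀ M : Finset (Sym2 X), covered (M.image (Sym2.map φ)) = φ '' covered M := by
    intro M
    ext v
    constructor
    · rintro ⟨e, he, hv⟩
      obtain ⟨e', he', rfl⟩ := Finset.mem_image.1 he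
      obtain ⟨a, ha, rfl⟩ := Sym2.mem_map.1 hv
      exact ⟨a, ⟨e', he', ha⟩, rfl⟩
    · rintro ⟨a, ⟨e, he, ha⟩, rfl⟩
      exact ⟨_, Finset.mem_image_of_mem _ he, Sym2.mem_map.2 ⟨a, ha, rfl⟩⟩
  constructor
  · intro N hN
    obtain ⟨M, hM, rfl⟩ := hB N hN.1
    rw [Finset.card_image_of_injective _ hinj]
    refine hg.1 M ⟨hM, fun M' hM' hc => ?_⟩
    exact Finset.image_injective hinj (hN.2 _ (hA M' hM') (by rw [hC, hC, hc]))
  · have hD : ∀ M, IsURMatching H M → IsURMatching K (M.image (Sym2.map φ)) := by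
      intro M hM
      refine ⟨hA M hM.1, fun N hN hc => ?_⟩
      obtain ⟨M', hM', rfl⟩ := hB N hN
      rw [hC, hC] at hc
      rw [hM.2 M' hM' (hφ.image_injective hc)]
    intro w
    by_cases hw : ∃ x, φ x = w
    · obtain ⟨x, rfl⟩ := hw
      obtain ⟨M, hM, hc, hx⟩ := hg.2 x
      refine ⟨_, hD M hM, by rw [Finset.card_image_of_injective _ hinj, hc], ?_⟩
      rw [hC]
      rintro ⟨y, hy, hyx⟩
      exact hx (hφ hyx ▸ hy)
    · obtain ⟨M, hM, hc, hx⟩ := hg.2 (Classical.arbitrary X)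
      refine ⟨_, hD M hM, by rw [Finset.card_image_of_injective _ hinj, hc], ?_⟩
      rw [hC]
      rintro ⟨y, hy, hyx⟩
      exact hw ⟨y, hyx⟩

/-- The fiber graph. -/
def fib {W V : Type} (G : SimpleGraph W) (π : W → V) (v : V) : SimpleGraph W where
  Adj a b := G.Adj a b ∧ π a = v ∧ π b = v
  symm := ⟨fun _ _ h => ⟨h.1.symm, h.2.2, h.2.1⟩⟩
  loopless := ⟨fun _ h => G.irrefl h.1⟩

lemma fib_le {W V : Type} (G : SimpleGraph W) (π : W → V) (v : V) : fib G π v ≤ G :=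
  fun _ _ h => h.1

lemma fib_block {W V : Type} (G : SimpleGraph W) (π : W → V) (s : V)
    (h : IsBlockB _ (G.induce (π ⁻¹' {s}))) :
    ∃ k, Nat.card {w // π w = s} = 3 * k + 1 ∧ Good (fib G π s) k := by
  have key : ∀ (n k : ℕ) (B : SimpleGraph (Fin n)), n = 3 * k + 1 → Good B k →
      Nonempty (G.induce (π ⁻¹' {s}) ≃g B) →
      ∃ k, Nat.card {w // π w = s} = 3 * k + 1 ∧ Good (fib G π s) k := by
    rintro n k B hn hB ⟨e⟩
    refine ⟨k, ?_, ?_⟩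
    · have h1 : Nat.card (π ⁻¹' {s}) = Nat.card (Fin n) := Nat.card_congr e.toEquiv
      rw [Nat.card_fin] at h1
      rw [← hn, ← h1]
      rfl
    · have : Nonempty (Fin n) := ⟨⟨0, by omega⟩⟩
      refine good_map (fun i => (e.symm i : W))
        (Subtype.val_injective.comp e.symm.injective) hB ?_
      intro a b
      constructor
      · rintro ⟨hab, ha, hb⟩
        refine ⟨e ⟨a, ha⟩, e ⟨b, hb⟩, ?_, by simp, by simp⟩
        rw [e.map_adj_iff]
        exact hab
      · rintro ⟨x, y, hxy, rfl, rfl⟩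
        have := e.symm.map_adj_iff.2 hxy
        exact ⟨this, (e.symm x).2, (e.symm y).2⟩
  rcases h with h | h | h | h | h | h | h | h | h
  · exact key _ 3 _ (by norm_num) good1 h
  · exact key _ 4 _ (by norm_num) good2 h
  · exact key _ 5 _ (by norm_num) good3 h
  · exact key _ 6 _ (by norm_num) good4 h
  · exact key _ 5 _ (by norm_num) good5 h
  · exact key _ 6 _ (by norm_num) good6 h
  · exact key _ 6 _ (by norm_num) good7 h
  · exact key _ 7 _ (by norm_num) good8 h
  · exact key _ 8 _ (by norm_num) good9 h

lemma fib_single {W V : Type} (G : SimpleGraph W) (π : W → V) (s : V)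
    (h : ∀ w w', π w = s → π w' = s → w = w') (hs : ∃ w, π w = s) :
    ∃ k, Nat.card {w // π w = s} = 3 * k + 1 ∧ Good (fib G π s) k := by
  have hno : ∀ M, IsMatchingSet (fib G π s) M → M = ∅ := by
    intro M hM
    rw [Finset.eq_empty_iff_forall_notMem]
    intro e he
    have := hM.1 e he
    induction e with
    | _ a b =>
      obtain ⟨h1, h2, h3⟩ : G.Adj a b ∧ π a = s ∧ π b = s := this
      exact h1.ne (h a b h2 h3)
  refine ⟨0, ?_, ?_, ?_⟩
  · rw [Nat.mul_zero, Nat.zero_add, Nat.card_eq_one_iff_unique]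
    obtain ⟨w, hw⟩ := hs
    exact ⟨⟨fun a b => Subtype.ext (h _ _ a.2 b.2)⟩, ⟨⟨w, hw⟩⟩⟩
  · intro M hM
    rw [hno M hM.1]; simp
  · intro w
    exact ⟨∅, ⟨⟨by simp, by simp⟩, fun M hM _ => hno M hM⟩, rfl, by simp [covered]⟩

section Core

variable {W V : Type} [Fintype W] [Fintype V] {G : SimpleGraph W} {T : SimpleGraph V} {π : W → V}
  {k : V → ℕ}

lemma core_upper (hP : ∀ a b, G.Adj a b → π a ≠ π b → T.Adj (π a) (π b))
    (hF : ∀ v, Good (fib G π v) (k v)) {K : Finset V}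
    (hK : ∀ a b, T.Adj a b → a ∈ K ∨ b ∈ K)
    (hK1 : ∀ v ∈ K, ∀ w w', π w = v → π w' = v → w = w')
    {M : Finset (Sym2 W)} (hM : IsURMatching G M) : M.card ≤ K.card + ∑ v, k v := by
  classical
  let N : V → Finset (Sym2 W) := fun v => M.filter (fun e => e ∈ (fib G π v).edgeSet)
  let R : Finset (Sym2 W) := M.filter (fun e => ∀ v, e ∉ (fib G π v).edgeSet)
  have hsub : M ⊆ R ∪ Finset.univ.biUnion N := by
    intro e he
    by_cases h : ∀ v, e ∉ (fib G π v).edgeSet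
    · exact Finset.mem_union_left _ (Finset.mem_filter.2 ⟨he, h⟩)
    · push Not at h
      obtain ⟨v, hv⟩ := h
      exact Finset.mem_union_right _ (Finset.mem_biUnion.2 ⟨v, Finset.mem_univ _,
        Finset.mem_filter.2 ⟨he, hv⟩⟩)
  have hN : ∀ v, (N v).card ≤ k v := fun v => (hF v).1 _
    (ur_subset (fib_le G π v) hM (Finset.filter_subset _ _) (fun e he => (Finset.mem_filter.1 he).2))
  have hR : R.card ≤ (Finset.univ.filter (fun w => π w ∈ K)).card := by
    refine cover_bound (fun e he f hf => hM.1.2 e (Finset.mem_filter.1 he).1 f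
      (Finset.mem_filter.1 hf).1) (Finset.univ.filter (fun w => π w ∈ K)) _ ?_ (fun y hy _ => hy)
    intro e he
    obtain ⟨he, hno⟩ := Finset.mem_filter.1 he
    have hadj := hM.1.1 e he
    induction e with
    | _ a b =>
      have hne : π a ≠ π b := fun h => hno (π a) ⟨hadj, rfl, h.symm⟩
      rcases hK _ _ (hP a b hadj hne) with h | h
      · exact ⟨a, by simp [h], by simp⟩
      · exact ⟨b, by simp [h], by simp⟩
  have hR' : (Finset.univ.filter (fun w => π w ∈ K)).card ≤ K.card := by
    refine Finset.card_le_card_of_injOn π (fun w hw => by simpa using hw) ?_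
    intro w hw w' hw' h
    exact hK1 (π w) (by simpa using hw) w w' rfl h.symm
  calc M.card ≤ (R ∪ Finset.univ.biUnion N).card := Finset.card_le_card hsub
    _ ≤ R.card + (Finset.univ.biUnion N).card := Finset.card_union_le _ _
    _ ≤ R.card + ∑ v, (N v).card := by gcongr; exact Finset.card_biUnion_le
    _ ≤ K.card + ∑ v, k v := by
        gcongr
        · exact hR.trans hR'
        · exact hN _

lemma cross_iff (hT : T.IsAcyclic)
    (hP : ∀ a b, G.Adj a b → π a ≠ π b → T.Adj (π a) (π b))
    (hU : ∀ a b a' b', G.Adj a b → G.Adj a' b' → π a = π a' → π b = π b' → π a ≠ π b →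
      a = a' ∧ b = b')
    {M M' : Finset (Sym2 W)} (hM : IsMatchingSet G M) (hM' : IsMatchingSet G M')
    (hc : covered M' = covered M) {a b : W} (hab : G.Adj a b) (hne : π a ≠ π b) :
    s(a, b) ∈ M' ↔ s(a, b) ∈ M := by
  let B : Set W := {w | (T.deleteEdges {s(π a, π b)}).Reachable (π a) (π w)}
  have hbr := SimpleGraph.isAcyclic_iff_forall_adj_isBridge.1 hT (hP a b hab hne)
  have hb : b ∉ B := by
    intro h
    exact (SimpleGraph.isBridge_iff.1 hbr) h
  have ha : a ∈ B := SimpleGraph.Reachable.refl _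
  have hcross : ∀ c d, G.Adj c d → c ∈ B → d ∉ B → s(c, d) = s(a, b) := by
    intro c d hcd hcB hdB
    have hcdne : π c ≠ π d := by
      intro h
      apply hdB
      change (T.deleteEdges {s(π a, π b)}).Reachable (π a) (π d)
      rw [← h]; exact hcB
    by_cases he : s(π c, π d) = s(π a, π b)
    · rcases Sym2.eq_iff.1 he with ⟨h1, h2⟩ | ⟨h1, h2⟩
      · obtain ⟨rfl, rfl⟩ := hU c d a b hcd hab h1 h2 hcdne
        rfl
      · obtain ⟨rfl, rfl⟩ := hU c d b a hcd hab.symm h1 h2 hcdne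
        exact Sym2.eq_swap
    · exfalso
      apply hdB
      have hadj : (T.deleteEdges {s(π a, π b)}).Adj (π c) (π d) := by
        rw [SimpleGraph.deleteEdges_adj]
        exact ⟨hP c d hcd hcdne, by simpa using he⟩
      exact SimpleGraph.Reachable.trans hcB hadj.reachable
  rw [parity hM B ha hb hcross, parity hM' B ha hb hcross, hc]

lemma core_lower [Nonempty W] (hT : T.IsAcyclic)
    (hP : ∀ a b, G.Adj a b → π a ≠ π b → T.Adj (π a) (π b))
    (hL : ∀ u v, T.Adj u v → ∃ a b, G.Adj a b ∧ π a = u ∧ π b = v)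
    (hU : ∀ a b a' b', G.Adj a b → G.Adj a' b' → π a = π a' → π b = π b' → π a ≠ π b →
      a = a' ∧ b = b')
    (hF : ∀ v, Good (fib G π v) (k v)) (hπ : Function.Surjective π)
    {N : Finset (Sym2 V)} (hN : IsMatchingSet T N) :
    ∃ M, IsURMatching G M ∧ M.card = N.card + ∑ v, k v := by
  classical
  have hlift : ∀ e ∈ N, ∃ f ∈ G.edgeSet, Sym2.map π f = e := by
    intro e he
    have := hN.1 e he
    induction e with
    | _ u v =>
      obtain ⟨a, b, hab, rfl, rfl⟩ := hL u v this
      exact ⟨s(a, b), hab, rfl⟩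
  have : Nonempty (Sym2 W) := ⟨s(Classical.arbitrary W, Classical.arbitrary W)⟩
  choose! l hlG hlπ using hlift
  have hlinj : Set.InjOn l (N : Set (Sym2 V)) := by
    intro e he f hf h
    rw [← hlπ e he, ← hlπ f hf, h]
  let R := N.image l
  have hRadj : ∀ e ∈ R, e ∈ G.edgeSet ∧ Sym2.map π e ∈ N := by
    intro e he
    obtain ⟨f, hf, rfl⟩ := Finset.mem_image.1 he
    exact ⟨hlG f hf, by rw [hlπ f hf]; exact hf⟩
  have hRne : ∀ a b, s(a, b) ∈ R → G.Adj a b ∧ π a ≠ π b := by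
    intro a b h
    obtain ⟨h1, h2⟩ := hRadj _ h
    have : T.Adj (π a) (π b) := hN.1 _ h2
    exact ⟨h1, this.ne⟩
  -- distinct edges of `R` touch different fibers
  have hRfib : ∀ e ∈ R, ∀ f ∈ R, ∀ a b, a ∈ e → b ∈ f → π a = π b → e = f := by
    intro e he f hf a b ha hb hab
    obtain ⟨e', he', rfl⟩ := Finset.mem_image.1 he
    obtain ⟨f', hf', rfl⟩ := Finset.mem_image.1 hf
    have h1 : π a ∈ e' := by rw [← hlπ e' he']; exact Sym2.mem_map.2 ⟨a, ha, rfl⟩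
    have h2 : π a ∈ f' := by rw [← hlπ f' hf', hab]; exact Sym2.mem_map.2 ⟨b, hb, rfl⟩
    rw [match_unique hN he' hf' h1 h2]
  have hRfib' : ∀ a ∈ covered R, ∀ b ∈ covered R, π a = π b → a = b := by
    rintro a ⟨e, he, ha⟩ b ⟨f, hf, hb⟩ hab
    obtain rfl := hRfib e he f hf a b ha hb hab
    obtain ⟨c, rfl⟩ := ha
    rcases Sym2.mem_iff.1 hb with rfl | rfl
    · rfl
    · exact absurd hab (hRne _ _ he).2
  have hw : ∀ v, ∃ w, ∀ a ∈ covered R, π a = v → a = w := by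
    intro v
    by_cases h : ∃ w ∈ covered R, π w = v
    · obtain ⟨w, hw, rfl⟩ := h
      exact ⟨w, fun a ha h => hRfib' a ha w hw h⟩
    · obtain ⟨w, _⟩ := hπ v
      exact ⟨w, fun a ha h' => absurd ⟨a, ha, h'⟩ h⟩
  choose w hw using hw
  choose Q hQ hQc hQw using fun v => (hF v).2 (w v)
  have hQadj : ∀ v a b, s(a, b) ∈ Q v → G.Adj a b ∧ π a = v ∧ π b = v :=
    fun v a b h => (hQ v).1.1 _ h
  have hQπ : ∀ v, ∀ e ∈ Q v, ∀ a ∈ e, π a = v := by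
    intro v e he a ha
    obtain ⟨b, rfl⟩ := ha
    exact (hQadj v a b he).2.1
  have hRQ : ∀ v a, a ∈ covered R → a ∈ covered (Q v) → False := by
    rintro v a haR ⟨e, he, hae⟩
    have h1 := hw v a haR (hQπ v e he a hae)
    exact hQw v (h1 ▸ ⟨e, he, hae⟩)
  let M := R ∪ Finset.univ.biUnion Q
  have hmem : ∀ e, e ∈ M ↔ e ∈ R ∨ ∃ v, e ∈ Q v := by
    intro e; simp [M]
  have hM : IsMatchingSet G M := by
    constructor
    · intro e he
      rcases (hmem e).1 he with h | ⟨v, h⟩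
      · exact (hRadj e h).1
      · exact SimpleGraph.edgeSet_mono (fib_le G π v) ((hQ v).1.1 e h)
    · intro e he f hf hne a ha ha'
      rcases (hmem e).1 he with h | ⟨v, h⟩ <;> rcases (hmem f).1 hf with h' | ⟨v', h'⟩
      · exact hne (hRfib e h f h' a a ha ha' rfl)
      · exact hRQ v' a ⟨e, h, ha⟩ ⟨f, h', ha'⟩
      · exact hRQ v a ⟨f, h', ha'⟩ ⟨e, h, ha⟩
      · have : v = v' := by rw [← hQπ v e h a ha, ← hQπ v' f h' a ha']
        subst this
        exact (hQ v).1.2 e h f h' hne a ha ha'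
  have hcross : ∀ a b, s(a, b) ∈ M → π a ≠ π b → s(a, b) ∈ R := by
    intro a b h hne
    rcases (hmem _).1 h with h | ⟨v, h⟩
    · exact h
    · obtain ⟨_, h1, h2⟩ := hQadj v a b h
      exact absurd (h1.trans h2.symm) hne
  refine ⟨M, ⟨hM, ?_⟩, ?_⟩
  · intro M' hM' hc
    have hX : ∀ a b, G.Adj a b → π a ≠ π b → (s(a, b) ∈ M' ↔ s(a, b) ∈ R) := by
      intro a b hab hne
      rw [cross_iff hT hP hU hM hM' hc hab hne]
      exact ⟨fun h => hcross a b h hne, fun h => (hmem _).2 (Or.inl h)⟩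
    have hRM' : ∀ e ∈ R, e ∈ M' := by
      intro e he
      induction e with
      | _ a b => exact (hX a b (hRne a b he).1 (hRne a b he).2).2 he
    have hfibM' : ∀ v, M'.filter (fun e => e ∈ (fib G π v).edgeSet) = Q v := by
      intro v
      refine (hQ v).2 _ ⟨fun e he => (Finset.mem_filter.1 he).2, fun e he f hf =>
        hM'.2 e (Finset.mem_filter.1 he).1 f (Finset.mem_filter.1 hf).1⟩ ?_
      ext a
      constructor
      · rintro ⟨e, he, hae⟩
        obtain ⟨he, hev⟩ := Finset.mem_filter.1 he
        obtain ⟨b, rfl⟩ := hae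
        obtain ⟨hab, ha, hb⟩ : G.Adj a b ∧ π a = v ∧ π b = v := hev
        have : a ∈ covered M := hc ▸ ⟨_, he, by simp⟩
        obtain ⟨f, hf, haf⟩ := this
        rcases (hmem f).1 hf with h | ⟨v', h⟩
        · have := match_unique hM' he (hRM' f h) (v := a) (by simp) haf
          subst this
          exact absurd (ha.trans hb.symm) (hRne a b h).2
        · have : v' = v := by rw [← hQπ v' f h a haf, ha]
          subst this
          exact ⟨f, h, haf⟩
      · rintro ⟨e, he, hae⟩
        have : a ∈ covered M' := hc ▸ ⟨e, (hmem e).2 (Or.inr ⟨v, he⟩), hae⟩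
        obtain ⟨f, hf, haf⟩ := this
        have hfG := hM'.1 f hf
        obtain ⟨b, rfl⟩ := haf
        have hpa := hQπ v e he a hae
        by_cases hne : π a = π b
        · exact ⟨s(a, b), Finset.mem_filter.2 ⟨hf, hfG, hpa, hne ▸ hpa⟩, by simp⟩
        · exact (hRQ v a ⟨s(a, b), (hX a b hfG hne).1 hf, by simp⟩ ⟨e, he, hae⟩).elim
    ext e
    rw [hmem]
    constructor
    · intro he
      have hG := hM'.1 e he
      induction e with
      | _ a b =>
        by_cases hne : π a = π b
        · right
          refine ⟨π a, ?_⟩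
          rw [← hfibM']
          exact Finset.mem_filter.2 ⟨he, hG, rfl, hne.symm⟩
        · exact Or.inl ((hX a b hG hne).1 he)
    · rintro (h | ⟨v, h⟩)
      · exact hRM' e h
      · rw [← hfibM'] at h
        exact (Finset.mem_filter.1 h).1
  · rw [Finset.card_union_of_disjoint, Finset.card_biUnion, Finset.card_image_of_injOn hlinj]
    · simp only [hQc]
    · intro v _ v' _ hne
      change Disjoint (Q v) (Q v')
      rw [Finset.disjoint_left]
      intro e he he'
      induction e with
      | _ a b => exact hne (by rw [← hQπ v _ he a (by simp), ← hQπ v' _ he' a (by simp)])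
    · rw [Finset.disjoint_left]
      intro e he he'
      simp only [Finset.mem_biUnion, Finset.mem_univ, true_and] at he'
      obtain ⟨v, hv⟩ := he'
      induction e with
      | _ a b => exact hRQ v a ⟨_, he, by simp⟩ ⟨_, hv, by simp⟩

end Core

end Main

/-- Lemma 7 of the paper. Every graph `G ∈ 𝒢` satisfies
`ν_ur(G) = (n(G) - 1)/3`, i.e. `3 ν_ur(G) + 1 = n(G)`. -/
theorem statement14 {W : Type} [Fintype W] (G : SimpleGraph W)
    (hG : InCalG G) :
    3 * nuUR G + 1 = Nat.card W := by
  obtain ⟨V, T, S, π, hV, ⟨hT, _, hcard⟩, hS, hsurj, hsing, hadj, hblock, hSS, hSA, hSN, _, _⟩ := hG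
  classical
  have := Fintype.ofFinite V
  obtain ⟨K, hK, hKc, hKD⟩ := exists_cover hT.isAcyclic
  have hKS : ∀ v ∈ K, v ∉ S := fun v hv h => hKD v hv (hS h)
  have hfib : ∀ v, ∃ k, Nat.card {w // π w = v} = 3 * k + 1 ∧ Good (fib G π v) k := by
    intro v
    by_cases hv : v ∈ S
    · exact fib_block G π v (hblock v hv)
    · exact fib_single G π v (hsing v hv) (hsurj v)
  choose k hk hgood using hfib
  have hP : ∀ a b, G.Adj a b → π a ≠ π b → T.Adj (π a) (π b) := by
    intro a b hab hne
    by_cases ha : π a ∈ S <;> by_cases hb : π b ∈ S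
    · exact absurd hab (hSS _ ha _ hb hne a b rfl rfl)
    · by_contra h
      exact hSN _ ha _ hb h a b rfl rfl hab
    · by_contra h
      exact hSN _ hb _ ha (fun h' => h h'.symm) b a rfl rfl hab.symm
    · exact (hadj a b ha hb).1 hab
  have hL : ∀ u v, T.Adj u v → ∃ a b, G.Adj a b ∧ π a = u ∧ π b = v := by
    intro u v huv
    by_cases ha : u ∈ S <;> by_cases hb : v ∈ S
    · rcases hK u v huv with h | h
      · exact absurd ha (hKS u h)
      · exact absurd hb (hKS v h)
    · obtain ⟨p, ⟨h1, h2, h3⟩, _⟩ := hSA u ha v hb huv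
      exact ⟨p.1, p.2, h3, h1, h2⟩
    · obtain ⟨p, ⟨h1, h2, h3⟩, _⟩ := hSA v hb u ha huv.symm
      exact ⟨p.2, p.1, h3.symm, h2, h1⟩
    · obtain ⟨a, rfl⟩ := hsurj u
      obtain ⟨b, rfl⟩ := hsurj v
      exact ⟨a, b, (hadj a b ha hb).2 huv, rfl, rfl⟩
  have hU : ∀ a b a' b', G.Adj a b → G.Adj a' b' → π a = π a' → π b = π b' → π a ≠ π b →
      a = a' ∧ b = b' := by
    intro a b a' b' hab hab' h1 h2 hne
    have ht := hP a b hab hne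
    by_cases ha : π a ∈ S <;> by_cases hb : π b ∈ S
    · exact absurd hab (hSS _ ha _ hb hne a b rfl rfl)
    · have := (hSA _ ha _ hb ht).unique (y₁ := (a, b)) (y₂ := (a', b')) ⟨rfl, rfl, hab⟩
        ⟨h1.symm, h2.symm, hab'⟩
      exact Prod.mk.inj this
    · have := (hSA _ hb _ ha ht.symm).unique (y₁ := (b, a)) (y₂ := (b', a')) ⟨rfl, rfl, hab.symm⟩
        ⟨h2.symm, h1.symm, hab'.symm⟩
      exact (Prod.mk.inj this).symm
    · exact ⟨hsing _ ha a a' rfl h1.symm, hsing _ hb b b' rfl h2.symm⟩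
  obtain ⟨N, hN, hNc⟩ := exists_nu T
  obtain ⟨w0, _⟩ := hsurj hT.connected.nonempty.some
  have : Nonempty W := ⟨w0⟩
  obtain ⟨M, hM, hMc⟩ := core_lower hT.isAcyclic hP hL hU hgood hsurj hN
  have hnu : nuUR G = nu T + ∑ v, k v := by
    have hub : ∀ M, IsURMatching G M → M.card ≤ nu T + ∑ v, k v := by
      intro M hM
      rw [← hKc]
      exact core_upper hP hgood hK (fun v hv => hsing v (hKS v hv)) hM
    apply le_antisymm
    · refine csSup_le ⟨_, M, hM, rfl⟩ ?_
      rintro m ⟨M, hM, rfl⟩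
      exact hub M hM
    · rw [← hNc, ← hMc]
      refine le_csSup ⟨nu T + ∑ v, k v, ?_⟩ ⟨M, hM, rfl⟩
      rintro m ⟨M, hM, rfl⟩
      exact hub M hM
  have hW : Nat.card W = ∑ v, (3 * k v + 1) := by
    rw [← Nat.card_congr (Equiv.sigmaFiberEquiv π), Nat.card_sigma]
    exact Finset.sum_congr rfl fun v _ => hk v
  rw [hW, hnu, Finset.sum_add_distrib, ← Finset.mul_sum]
  have : Nat.card V = ∑ v : V, 1 := by simp
  omega

end URPaper
end
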